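/- For every integer t ≥ 1 there exists n_0 such that for all n ≥ n_0: every F_sim(t)-free 3-graph on n vertices with exactly ex_3(n, F_sim(t)) hyperedges is isomorphic to the following 3-graph: take the balanced complete 3-partite 3-graph T_3(n−t,3), add a set X of t further vertices, and add as hyperedges all 3-subsets of X and all triples consisting of one vertex of X together with two vertices lying in a common part of T_3(n−t,3). -/

import Mathlib

open Finset

/-- `H` (a 3-graph given by its edge set on vertex type `V`) contains a copy of the
3-graph `F` (given by its edge set on vertex type `W`). -/
def HasCopy {V W : Type*} [DecidableEq V] [DecidableEq W]
    (H : Finset (Finset V)) (F : Finset (Finset W)) : Prop :=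
  ∃ f : W ↪ V, ∀ e ∈ F, e.image f ∈ H

/-- The Turán number `ex_3(n, F)`: the maximum number of hyperedges of an `F`-free
3-uniform hypergraph on `n` vertices. -/
noncomputable def exThree {W : Type*} [DecidableEq W] (n : ℕ) (F : Finset (Finset W)) : ℕ :=
  sSup {k | ∃ H : Finset (Finset (Fin n)), (∀ e ∈ H, e.card = 3) ∧ ¬ HasCopy H F ∧ H.card = k}

/-- The `i`-th part of the balanced tripartition of `Fin n` (vertices with residue `i` mod 3);
the parts have sizes `⌊n/3⌋` or `⌈n/3⌉`. -/
def turanPart (n : ℕ) (i : Fin 3) : Finset (Fin n) :=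
  Finset.univ.filter (fun v => (v : ℕ) % 3 = (i : ℕ))

/-- The balanced complete tripartite 3-graph `T_3(n,3)`: hyperedges are exactly the triples
with one vertex in each part of the balanced tripartition. -/
def T3 (n : ℕ) : Finset (Finset (Fin n)) :=
  Finset.univ.filter (fun e => e.card = 3 ∧ ∀ i : Fin 3, (e ∩ turanPart n i).card = 1)

/-- The 3-graph `F_5` on `{f_1, …, f_5}` with hyperedges `f_1f_2f_3, f_1f_2f_4, f_3f_4f_5`. -/
def F5 : Finset (Finset (Fin 5)) := {{0,1,2},{0,1,3},{2,3,4}}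

/-- `F_5(f_5;t)`: `F_5` with the vertex `f_5` blown up to `t` copies.
Here `inl 0, inl 1, inl 2, inl 3` play the roles of `f_1,f_2,f_3,f_4` and the
vertices `inr j` are the `t` copies of `f_5`. -/
def F5b5 (t : ℕ) : Finset (Finset (Fin 4 ⊕ Fin t)) :=
  ({({Sum.inl 0, Sum.inl 1, Sum.inl 2} : Finset (Fin 4 ⊕ Fin t)),
    ({Sum.inl 0, Sum.inl 1, Sum.inl 3} : Finset (Fin 4 ⊕ Fin t))} :
      Finset (Finset (Fin 4 ⊕ Fin t))) ∪
  Finset.univ.image (fun j : Fin t => ({Sum.inl 2, Sum.inl 3, Sum.inr j} : Finset (Fin 4 ⊕ Fin t)))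

/-- `F_5(f_3;t)`: `F_5` with the vertex `f_3` blown up to `t` copies.
Here `inl 0, inl 1, inl 2, inl 3` play the roles of `f_1,f_2,f_4,f_5` and the
vertices `inr j` are the `t` copies of `f_3`. -/
def F5b3 (t : ℕ) : Finset (Finset (Fin 4 ⊕ Fin t)) :=
  ({({Sum.inl 0, Sum.inl 1, Sum.inl 2} : Finset (Fin 4 ⊕ Fin t))} :
      Finset (Finset (Fin 4 ⊕ Fin t))) ∪
  Finset.univ.image (fun j : Fin t => ({Sum.inl 0, Sum.inl 1, Sum.inr j} : Finset (Fin 4 ⊕ Fin t))) ∪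
  Finset.univ.image (fun j : Fin t => ({Sum.inr j, Sum.inl 2, Sum.inl 3} : Finset (Fin 4 ⊕ Fin t)))

/-- `S^t(N)` (the size of `D(N,3,t,2)`): the maximum number of hyperedges of a 3-graph on `N`
vertices in which every pair of vertices is contained in at most `t-1` hyperedges. -/
noncomputable def Dmax (N t : ℕ) : ℕ :=
  sSup {k | ∃ H : Finset (Finset (Fin N)), (∀ e ∈ H, e.card = 3) ∧
    (∀ u v : Fin N, u ≠ v → (H.filter (fun e => u ∈ e ∧ v ∈ e)).card ≤ t - 1) ∧ H.card = k}

/-- `e(T_3(n,3)^{t+})`: the number of hyperedges of `T_3(n,3)` together with a maximum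
3-graph inside each part in which every pair of vertices lies in at most `t-1` hyperedges. -/
noncomputable def eT3plus (n t : ℕ) : ℕ :=
  (T3 n).card + ∑ i : Fin 3, Dmax ((turanPart n i).card) t

/-- `F` is a subgraph of a blow-up of `F_5`: every edge is a triple, and there is a map
to `V(F_5)` that is injective on each edge and sends each edge to an edge of `F_5`. -/
def IsSubBlowupF5 {W : Type*} [DecidableEq W] (F : Finset (Finset W)) : Prop :=
  (∀ e ∈ F, e.card = 3) ∧ ∃ φ : W → Fin 5, ∀ e ∈ F, (e.image φ).card = 3 ∧ e.image φ ∈ F5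

/-- The complete tripartite 3-graph with parts `A`, `B`, `C`: all triples with exactly
one vertex in each of `A`, `B`, `C`. -/
def tripartiteEdges {n : ℕ} (A B C : Finset (Fin n)) : Finset (Finset (Fin n)) :=
  Finset.univ.filter (fun e =>
    (e ∩ A).card = 1 ∧ (e ∩ B).card = 1 ∧ (e ∩ C).card = 1 ∧ e.card = 3)

/-- The complete 3-partite 3-graph `K_{t,s,s}` with parts of sizes `t`, `s`, `s`. -/
def Ktss (t s : ℕ) : Finset (Finset (Fin t ⊕ Fin s ⊕ Fin s)) :=
  Finset.univ.image (fun x : Fin t × Fin s × Fin s =>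
    ({Sum.inl x.1, Sum.inr (Sum.inl x.2.1), Sum.inr (Sum.inr x.2.2)} :
      Finset (Fin t ⊕ Fin s ⊕ Fin s)))

/-- All hyperedges of `H` consist of one vertex of the `A`-side (`Fin mA`) and two
vertices of the `B`-side (`Fin nB`). -/
def BipShape (mA nB : ℕ) (H : Finset (Finset (Fin mA ⊕ Fin nB))) : Prop :=
  ∀ e ∈ H, ∃ a : Fin mA, ∃ b c : Fin nB, b ≠ c ∧
    e = ({Sum.inl a, Sum.inr b, Sum.inr c} : Finset (Fin mA ⊕ Fin nB))

/-- `H` contains a copy of `K_{t,s,s}` whose `t`-vertex part lies on the `A`-side and whose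
two `s`-vertex parts lie on the `B`-side. -/
def HasBipKtss (mA nB t s : ℕ) (H : Finset (Finset (Fin mA ⊕ Fin nB))) : Prop :=
  ∃ (T : Finset (Fin mA)) (S0 S1 : Finset (Fin nB)), T.card = t ∧
    S0.card = s ∧ S1.card = s ∧ Disjoint S0 S1 ∧
    ∀ a ∈ T, ∀ b ∈ S0, ∀ c ∈ S1,
      ({Sum.inl a, Sum.inr b, Sum.inr c} : Finset (Fin mA ⊕ Fin nB)) ∈ H

/-- The bipartite Turán number `ex_3^{bip}(mA, nB, K_{t,s,s})`. -/
noncomputable def exBip (mA nB t s : ℕ) : ℕ :=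
  sSup {k | ∃ H : Finset (Finset (Fin mA ⊕ Fin nB)),
    BipShape mA nB H ∧ ¬ HasBipKtss mA nB t s H ∧ H.card = k}

/-- The `s`-set `S_0` inside the residue-0 part of `T_3(3m,3)`. -/
def S0set (m s : ℕ) (h : 2*s ≤ m) : Finset (Fin (3*m)) :=
  Finset.univ.image (fun i : Fin s => (⟨3*i.val, by have := i.isLt; omega⟩ : Fin (3*m)))

/-- The `s`-set `S_1` inside the residue-0 part of `T_3(3m,3)`, disjoint from `S_0`. -/
def S1set (m s : ℕ) (h : 2*s ≤ m) : Finset (Fin (3*m)) :=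
  Finset.univ.image (fun i : Fin s => (⟨3*(s+i.val), by have := i.isLt; omega⟩ : Fin (3*m)))

/-- The 3-graph `F_5^S(m,t,K_{s,s})`: `T_3(3m,3)` (on the `inl` vertices) together with a set
`T` of `t` new vertices (the `inr` vertices) and all triples consisting of one vertex of `T`,
one vertex of `S_0` and one vertex of `S_1`. -/
def F5Stss (m t s : ℕ) (h : 2*s ≤ m) : Finset (Finset (Fin (3*m) ⊕ Fin t)) :=
  (T3 (3*m)).image (fun e => e.image Sum.inl) ∪
  Finset.univ.biUnion (fun j : Fin t =>
    ((S0set m s h) ×ˢ (S1set m s h)).image (fun p =>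
      ({Sum.inr j, Sum.inl p.1, Sum.inl p.2} : Finset (Fin (3*m) ⊕ Fin t))))

/-- `F_sim(t)`: the 3-graph with hyperedges `f_1f_2f_3, f_1f_2f_4, f_3f_4f_5, f_5f_6f_7,
f_6f_7f_8` in which `f_8` is blown up to `t` copies. Here `inl 0, …, inl 6` play the roles
of `f_1, …, f_7` and the vertices `inr j` are the `t` copies of `f_8`. -/
def Fsim (t : ℕ) : Finset (Finset (Fin 7 ⊕ Fin t)) :=
  ({({Sum.inl 0, Sum.inl 1, Sum.inl 2} : Finset (Fin 7 ⊕ Fin t)),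
    ({Sum.inl 0, Sum.inl 1, Sum.inl 3} : Finset (Fin 7 ⊕ Fin t)),
    ({Sum.inl 2, Sum.inl 3, Sum.inl 4} : Finset (Fin 7 ⊕ Fin t)),
    ({Sum.inl 4, Sum.inl 5, Sum.inl 6} : Finset (Fin 7 ⊕ Fin t))} :
      Finset (Finset (Fin 7 ⊕ Fin t))) ∪
  Finset.univ.image (fun j : Fin t => ({Sum.inl 5, Sum.inl 6, Sum.inr j} : Finset (Fin 7 ⊕ Fin t)))

/-- The 3-graph with parts `A`, `B`, `C` and an extra clique `X`: its hyperedges are the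
triples with one vertex in each of `A`, `B`, `C`, all 3-subsets of `X`, and the triples with
one vertex in `X` and two vertices in a common part among `A`, `B`, `C`. -/
def simConstr (n : ℕ) (A B C X : Finset (Fin n)) : Finset (Finset (Fin n)) :=
  Finset.univ.filter (fun e => e.card = 3 ∧
    (((e ∩ A).card = 1 ∧ (e ∩ B).card = 1 ∧ (e ∩ C).card = 1) ∨
     e ⊆ X ∨
     ((e ∩ X).card = 1 ∧ ((e ∩ A).card = 2 ∨ (e ∩ B).card = 2 ∨ (e ∩ C).card = 2))))

/-- `F_5^S(m)`: `T_3(3m,3)` together with one new vertex `v = inr ()` and one hyperedge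
consisting of `v` and two vertices (`0` and `3`) lying in one part of `T_3(3m,3)`. -/
def F5Sm (m : ℕ) (hm : 2 ≤ m) : Finset (Finset (Fin (3*m) ⊕ Unit)) :=
  (T3 (3*m)).image (fun e => e.image Sum.inl) ∪
  {({Sum.inr (), Sum.inl ⟨0, by omega⟩, Sum.inl ⟨3, by omega⟩} : Finset (Fin (3*m) ⊕ Unit))}

/-- The disjoint union of `k` vertex-disjoint copies of the 3-graph `F`. -/
def copies (k : ℕ) {W : Type*} [DecidableEq W] (F : Finset (Finset W)) :
    Finset (Finset (Fin k × W)) :=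
  Finset.univ.biUnion (fun j : Fin k => F.image (fun e => e.image (fun w => (j, w))))

/-- The 3-graph `G(t,m,n)` (it does not depend on `m`): the vertices `v < t` form the set
`T`, the remaining `n - t` vertices carry a copy of `T_3(n-t,3)` (parts by residue of
`v - t` mod 3), and the hyperedges are those of this `T_3(n-t,3)` together with all
3-sets of vertices intersecting `T`. -/
def Gtmn (t n : ℕ) : Finset (Finset (Fin n)) :=
  Finset.univ.filter (fun e => e.card = 3 ∧
    ((∃ v ∈ e, (v : ℕ) < t) ∨
     (∀ i : Fin 3, (e.filter (fun v : Fin n => t ≤ (v : ℕ) ∧ ((v : ℕ) - t) % 3 = (i : ℕ))).card = 1)))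

/-- The blow-up of `F_5` in which every vertex is replaced by `t` copies:
the vertex `(i, j)` is the `j`-th copy of `f_{i+1}`. -/
def F5blowAll (t : ℕ) : Finset (Finset (Fin 5 × Fin t)) :=
  Finset.univ.biUnion (fun x : Fin t × Fin t × Fin t =>
    ({ ({((0:Fin 5), x.1), ((1:Fin 5), x.2.1), ((2:Fin 5), x.2.2)} : Finset (Fin 5 × Fin t)),
       ({((0:Fin 5), x.1), ((1:Fin 5), x.2.1), ((3:Fin 5), x.2.2)} : Finset (Fin 5 × Fin t)),
       ({((2:Fin 5), x.1), ((3:Fin 5), x.2.1), ((4:Fin 5), x.2.2)} : Finset (Fin 5 × Fin t)) } :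
      Finset (Finset (Fin 5 × Fin t))))

namespace TripleSystem

/-- A 3-graph on `V`, presented as a symmetric relation on triples of distinct vertices. -/
structure TSys (V : Type*) where
  /-- The ternary adjacency relation. -/
  E : V → V → V → Prop
  swap : ∀ {a b c}, E a b c → E b a c
  rot : ∀ {a b c}, E a b c → E b c a
  ne : ∀ {a b c}, E a b c → a ≠ b

namespace TSys

variable {V : Type*}

lemma ne_right (H : TSys V) {a b c : V} (h : H.E a b c) : b ≠ c := H.ne (H.rot h)

lemma ne_outer (H : TSys V) {a b c : V} (h : H.E a b c) : a ≠ c := (H.ne (H.rot (H.rot h))).symm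

lemma swap_right (H : TSys V) {a b c : V} (h : H.E a b c) : H.E a c b := H.rot (H.swap h)

end TSys

section Turan

open scoped Classical in
lemma turan_card_adj_le {V : Type*} [Fintype V] (Γ : SimpleGraph V) {r : ℕ}
    (h : Γ.CliqueFree (r + 1)) :
    r * #{x : V × V | Γ.Adj x.1 x.2} ≤ (r - 1) * Fintype.card V ^ 2 := by
  have h1 : #{x : V × V | Γ.Adj x.1 x.2} = 2 * #Γ.edgeFinset := by
    rw [← Γ.sum_degrees_eq_twice_card_edges, ← univ_product_univ, card_filter, sum_product]
    refine sum_congr rfl fun v _ => ?_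
    rw [← card_filter, ← SimpleGraph.card_neighborFinset_eq_degree]
    congr 1
    ext w
    simp
  have h2 := SimpleGraph.CliqueFree.card_edgeFinset_le h
  have h3 : #Γ.edgeFinset ≤ #(SimpleGraph.turanGraph (Fintype.card V) r).edgeFinset := by
    rw [SimpleGraph.card_edgeFinset_turanGraph]
    convert h2 using 1
  have h4 := SimpleGraph.mul_card_edgeFinset_turanGraph_le (n := Fintype.card V) (r := r)
  rw [h1]
  calc r * (2 * #Γ.edgeFinset) = 2 * r * #Γ.edgeFinset := by ring
    _ ≤ _ := Nat.mul_le_mul_left _ h3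
    _ ≤ _ := h4

open scoped Classical in
lemma mantel_card_adj_le {V : Type*} [Fintype V] (Γ : SimpleGraph V) (U : Finset V)
    (h : ∀ a ∈ U, ∀ b ∈ U, ∀ c ∈ U, Γ.Adj a b → Γ.Adj b c → Γ.Adj a c → False) :
    2 * #{x : V × V | x.1 ∈ U ∧ x.2 ∈ U ∧ Γ.Adj x.1 x.2} ≤ #U ^ 2 := by
  have hcf : (Γ.comap (Subtype.val : {v // v ∈ U} → V)).CliqueFree (2 + 1) := by
    intro s hs
    obtain ⟨a, b, c, hab, hac, hbc, -⟩ := SimpleGraph.is3Clique_iff.1 hs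
    exact h a a.2 b b.2 c c.2 hab hbc hac
  have h1 := turan_card_adj_le _ hcf
  have h2 : #{x : V × V | x.1 ∈ U ∧ x.2 ∈ U ∧ Γ.Adj x.1 x.2} ≤
      #{x : {v // v ∈ U} × {v // v ∈ U} |
        (Γ.comap (Subtype.val : {v // v ∈ U} → V)).Adj x.1 x.2} := by
    refine le_trans (card_le_card ?_)
      (card_image_le (f := fun x : {v // v ∈ U} × {v // v ∈ U} => (x.1.1, x.2.1)))
    rintro ⟨a, b⟩ hx
    simp only [mem_filter, mem_univ, true_and] at hx
    simp only [mem_image, mem_filter, mem_univ, true_and, SimpleGraph.comap_adj]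
    exact ⟨(⟨a, hx.1⟩, ⟨b, hx.2.1⟩), hx.2.2, rfl⟩
  simp only [Fintype.card_coe] at h1
  rw [show 2 - 1 = 1 from rfl, one_mul] at h1
  refine (Nat.mul_le_mul_left 2 h2).trans (le_of_eq_of_le ?_ h1)
  congr!
  trace_state

end Turan

section Cancellative

variable {V : Type*}

/-- The shadow graph of a 3-graph. -/
def shadow (H : TSys V) : SimpleGraph V where
  Adj x y := ∃ z, H.E x y z
  symm := ⟨fun _ _ ⟨z, hz⟩ => ⟨z, H.swap hz⟩⟩
  loopless := ⟨fun _ ⟨_, hz⟩ => H.ne hz rfl⟩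

/-- In a cancellative 3-graph two vertices covered by an edge have disjoint links. -/
def Cancellative (H : TSys V) : Prop :=
  ∀ x y z p q, H.E x y z → H.E p q x → H.E p q y → False

open scoped Classical in
/-- The number of ordered pairs in the link of `v`. -/
noncomputable def ld [Fintype V] (H : TSys V) (v : V) : ℕ := #{x : V × V | H.E v x.1 x.2}

open scoped Classical in
lemma card_mul_le_of_clique [Fintype V] {H : TSys V} (hc : Cancellative H) {s : Finset V}
    (hs : (shadow H).IsClique s) {d : ℕ} (hd : ∀ v, d ≤ ld H v) :
    #s * d ≤ #{x : V × V | (shadow H).Adj x.1 x.2} := by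
  have hdis : (s : Set V).PairwiseDisjoint
      (fun v => ({x : V × V | H.E v x.1 x.2} : Finset (V × V))) := by
    intro a ha b hb hab
    obtain ⟨z, hz⟩ := hs ha hb hab
    rw [Function.onFun, disjoint_left]
    rintro ⟨p, q⟩ h1 h2
    simp only [mem_filter, mem_univ, true_and] at h1 h2
    exact hc a b z p q hz (H.rot h1) (H.rot h2)
  calc #s * d = ∑ _v ∈ s, d := by simp
    _ ≤ ∑ v ∈ s, ld H v := sum_le_sum fun v _ => hd v
    _ = #(s.biUnion fun v => ({x : V × V | H.E v x.1 x.2} : Finset (V × V))) :=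
        (card_biUnion hdis).symm
    _ ≤ _ := by
        refine card_le_card fun x hx => ?_
        simp only [mem_biUnion, mem_filter, mem_univ, true_and] at hx ⊢
        obtain ⟨a, -, ha⟩ := hx
        exact ⟨a, H.rot ha⟩

open scoped Classical in
/-- A cancellative 3-graph of large minimum degree is tripartite. -/
theorem exists_coloring_of_cancellative [Fintype V] {H : TSys V} (hc : Cancellative H)
    (hm : 200 ≤ Fintype.card V)
    (hd : ∀ v, 3 * Fintype.card V ^ 2 ≤ 14 * ld H v + 3 * Fintype.card V) :
    ∃ κ : V → Fin 3, ∀ a b c, H.E a b c → κ a ≠ κ b := by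
  set m := Fintype.card V with hmdef
  obtain ⟨d, hd1, hd2⟩ : ∃ d : ℕ, (∀ v, d ≤ ld H v) ∧ 3 * m ^ 2 ≤ 14 * d + 3 * m := by
    have : Nonempty V := Fintype.card_pos_iff.1 (by omega)
    obtain ⟨v, -, hv⟩ := exists_min_image (univ : Finset V) (ld H) univ_nonempty
    exact ⟨ld H v, fun w => hv w (mem_univ w), hd v⟩
  have hmm : 200 * m ≤ m ^ 2 := by nlinarith
  have hcf5 : (shadow H).CliqueFree 5 := by
    intro s hs
    have h1 := card_mul_le_of_clique hc hs.isClique hd1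
    rw [hs.card_eq] at h1
    have h2 : #{x : V × V | (shadow H).Adj x.1 x.2} ≤ m ^ 2 := by
      refine (card_le_univ _).trans ?_
      rw [Fintype.card_prod, sq]
    nlinarith
  have hcf4 : (shadow H).CliqueFree 4 := by
    intro s hs
    have h1 := card_mul_le_of_clique hc hs.isClique hd1
    rw [hs.card_eq] at h1
    have h2 := turan_card_adj_le (shadow H) (r := 4) hcf5
    norm_num at h2
    rw [← hmdef] at h2
    nlinarith
  have hdeg : ∀ v, 5 * m < 8 * (shadow H).degree v := by
    intro v
    have h1 := mantel_card_adj_le (shadow H) ((shadow H).neighborFinset v) (by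
      intro a ha b hb c hcc hab hbc hac
      simp only [SimpleGraph.mem_neighborFinset] at ha hb hcc
      have hcl := SimpleGraph.is3Clique_triple_iff.2 ⟨hab, hac, hbc⟩
      refine hcf4 _ (hcl.insert (a := v) ?_)
      simp [ha, hb, hcc])
    rw [SimpleGraph.card_neighborFinset_eq_degree] at h1
    have h2 : ld H v ≤ #{x : V × V | x.1 ∈ (shadow H).neighborFinset v ∧
        x.2 ∈ (shadow H).neighborFinset v ∧ (shadow H).Adj x.1 x.2} := by
      refine card_le_card ?_
      rintro ⟨p, q⟩ hx
      simp only [mem_filter, mem_univ, true_and, SimpleGraph.mem_neighborFinset] at hx ⊢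
      exact ⟨⟨q, hx⟩, ⟨p, H.swap_right hx⟩, ⟨v, H.rot hx⟩⟩
    have h3 := hd1 v
    by_contra! h4
    have h5 : 64 * (shadow H).degree v ^ 2 ≤ 25 * m ^ 2 := by nlinarith
    nlinarith
  have hcol : (shadow H).Colorable 3 := by
    refine SimpleGraph.colorable_of_cliqueFree_lt_minDegree hcf4 ?_
    have : Nonempty V := Fintype.card_pos_iff.1 (by omega)
    obtain ⟨v, hv⟩ := (shadow H).exists_minimal_degree_vertex
    have := hdeg v
    rw [hv]
    norm_num
    rw [← hmdef]
    omega
  obtain ⟨κ⟩ := hcol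
  exact ⟨κ, fun a b c h => κ.valid ⟨c, h⟩⟩

end Cancellative

section Counting

variable {V : Type*} [Fintype V]

open scoped Classical in
/-- The number of vertices satisfying `P`. -/
noncomputable def cnt1 (P : V → Prop) : ℕ := #{x : V | P x}

open scoped Classical in
/-- The number of ordered pairs satisfying `P`. -/
noncomputable def cnt2 (P : V → V → Prop) : ℕ := #{x : V × V | P x.1 x.2}

open scoped Classical in
/-- The number of ordered triples satisfying `P`. -/
noncomputable def cnt3 (P : V → V → V → Prop) : ℕ := #{x : V × V × V | P x.1 x.2.1 x.2.2}

lemma cnt1_mono {P Q : V → Prop} (h : ∀ a, P a → Q a) : cnt1 P ≤ cnt1 Q := by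
  classical
  refine card_le_card fun x hx => ?_
  simp only [mem_filter, mem_univ, true_and] at hx ⊢
  exact h _ hx

lemma cnt2_mono {P Q : V → V → Prop} (h : ∀ a b, P a b → Q a b) : cnt2 P ≤ cnt2 Q := by
  classical
  refine card_le_card fun x hx => ?_
  simp only [mem_filter, mem_univ, true_and] at hx ⊢
  exact h _ _ hx

lemma cnt3_mono {P Q : V → V → V → Prop} (h : ∀ a b c, P a b c → Q a b c) :
    cnt3 P ≤ cnt3 Q := by
  classical
  refine card_le_card fun x hx => ?_
  simp only [mem_filter, mem_univ, true_and] at hx ⊢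
  exact h _ _ _ hx

lemma cnt1_or_le (P Q : V → Prop) : cnt1 (fun a => P a ∨ Q a) ≤ cnt1 P + cnt1 Q := by
  classical
  refine le_trans (card_le_card fun x hx => ?_) (card_union_le _ _)
  simpa [mem_union, mem_filter] using hx

lemma cnt2_or_le (P Q : V → V → Prop) :
    cnt2 (fun a b => P a b ∨ Q a b) ≤ cnt2 P + cnt2 Q := by
  classical
  refine le_trans (card_le_card fun x hx => ?_) (card_union_le _ _)
  simpa [mem_union, mem_filter] using hx

lemma cnt3_or_le (P Q : V → V → V → Prop) :
    cnt3 (fun a b c => P a b c ∨ Q a b c) ≤ cnt3 P + cnt3 Q := by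
  classical
  refine le_trans (card_le_card fun x hx => ?_) (card_union_le _ _)
  simpa [mem_union, mem_filter] using hx

lemma cnt1_le_card (P : V → Prop) : cnt1 P ≤ Fintype.card V := card_le_univ _

lemma cnt2_le_sq (P : V → V → Prop) : cnt2 P ≤ Fintype.card V ^ 2 := by
  classical
  refine (card_le_univ _).trans ?_
  rw [Fintype.card_prod, sq]

lemma cnt2_eq_sum (P : V → V → Prop) : cnt2 P = ∑ a, cnt1 (P a) := by
  classical
  simp only [cnt1, cnt2, card_filter, Fintype.sum_prod_type]

lemma cnt3_eq_sum (P : V → V → V → Prop) : cnt3 P = ∑ a, cnt2 (P a) := by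
  classical
  simp only [cnt2, cnt3, card_filter, Fintype.sum_prod_type]

lemma cnt3_eq_sum_pair (P : V → V → V → Prop) :
    cnt3 P = ∑ x : V × V, cnt1 (P x.1 x.2) := by
  rw [cnt3_eq_sum, Fintype.sum_prod_type]
  exact sum_congr rfl fun a _ => cnt2_eq_sum _

lemma cnt2_swap (P : V → V → Prop) : cnt2 (fun a b => P b a) = cnt2 P := by
  classical
  refine card_equiv (Equiv.prodComm V V) ?_
  simp

lemma cnt3_rot (P : V → V → V → Prop) : cnt3 (fun a b c => P b c a) = cnt3 P := by
  classical
  refine card_equiv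
    ⟨fun x => (x.2.1, x.2.2, x.1), fun x => (x.2.2, x.1, x.2.1), fun _ => rfl, fun _ => rfl⟩ ?_
  simp

lemma cnt3_swap_right (P : V → V → V → Prop) : cnt3 (fun a b c => P a c b) = cnt3 P := by
  simp only [cnt3_eq_sum]
  exact sum_congr rfl fun a _ => cnt2_swap _

lemma cnt3_add_not (P Q : V → V → V → Prop) :
    cnt3 P = cnt3 (fun a b c => P a b c ∧ Q a b c) + cnt3 (fun a b c => P a b c ∧ ¬ Q a b c) := by
  classical
  simp only [cnt3, ← filter_filter]
  exact (card_filter_add_card_filter_not _).symm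

lemma cnt2_add_not (P Q : V → V → Prop) :
    cnt2 P = cnt2 (fun a b => P a b ∧ Q a b) + cnt2 (fun a b => P a b ∧ ¬ Q a b) := by
  classical
  simp only [cnt2, ← filter_filter]
  exact (card_filter_add_card_filter_not _).symm

lemma cnt1_add_not (P Q : V → Prop) :
    cnt1 P = cnt1 (fun a => P a ∧ Q a) + cnt1 (fun a => P a ∧ ¬ Q a) := by
  classical
  simp only [cnt1, ← filter_filter]
  exact (card_filter_add_card_filter_not _).symm

lemma cnt1_mem (U : Finset V) : cnt1 (fun a => a ∈ U) = #U := by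
  classical
  simp [cnt1]

lemma cnt2_prod (P Q : V → Prop) : cnt2 (fun a b => P a ∧ Q b) = cnt1 P * cnt1 Q := by
  classical
  rw [cnt1, cnt1, ← card_product, cnt2]
  congr 1
  ext x
  simp

lemma cnt3_prod (P : V → Prop) (Q : V → V → Prop) :
    cnt3 (fun a b c => P a ∧ Q b c) = cnt1 P * cnt2 Q := by
  classical
  rw [cnt1, cnt2, ← card_product, cnt3]
  congr 1
  ext x
  simp

/-- Pairs with the first entry satisfying `P` contribute at most the maximal fibre size. -/
lemma cnt2_and_le {P : V → Prop} {R : V → V → Prop} {k : ℕ} (h : ∀ a, P a → cnt1 (R a) ≤ k) :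
    cnt2 (fun a b => P a ∧ R a b) ≤ cnt1 P * k := by
  classical
  rw [cnt2_eq_sum, cnt1, card_filter, sum_mul]
  refine sum_le_sum fun a _ => ?_
  by_cases ha : P a
  · simpa [ha] using h a ha
  · simp [ha, cnt1]

lemma cnt3_and_le {P : V → V → Prop} {R : V → V → V → Prop} {k : ℕ}
    (h : ∀ a b, P a b → cnt1 (R a b) ≤ k) :
    cnt3 (fun a b c => P a b ∧ R a b c) ≤ cnt2 P * k := by
  classical
  rw [cnt3_eq_sum_pair, cnt2, card_filter, sum_mul]
  refine sum_le_sum fun a _ => ?_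
  by_cases ha : P a.1 a.2
  · simpa [ha] using h _ _ ha
  · simp [ha, cnt1]

lemma le_cnt3_and {P : V → V → Prop} {R : V → V → V → Prop} {k : ℕ}
    (h : ∀ a b, P a b → k ≤ cnt1 (R a b)) :
    cnt2 P * k ≤ cnt3 (fun a b c => P a b ∧ R a b c) := by
  classical
  rw [cnt3_eq_sum_pair, cnt2, card_filter, sum_mul]
  refine sum_le_sum fun a _ => ?_
  by_cases ha : P a.1 a.2
  · simpa [ha] using h _ _ ha
  · simp [ha]

lemma cnt3_and_le_left {P : V → Prop} {R : V → V → V → Prop} {k : ℕ}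
    (h : ∀ a, P a → cnt2 (R a) ≤ k) :
    cnt3 (fun a b c => P a ∧ R a b c) ≤ cnt1 P * k := by
  classical
  rw [cnt3_eq_sum, cnt1, card_filter, sum_mul]
  refine sum_le_sum fun a _ => ?_
  by_cases ha : P a
  · simpa [ha] using h _ ha
  · simp [ha, cnt2]

lemma cnt2_touch_le (U : Finset V) :
    cnt2 (fun a b => a ∈ U ∨ b ∈ U) ≤ 2 * #U * Fintype.card V := by
  have h1 : cnt2 (fun a _ => a ∈ U) = #U * Fintype.card V := by
    have := cnt2_prod (fun a => a ∈ U) (fun _ : V => True)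
    simp only [and_true, cnt1_mem] at this
    rw [this]
    simp [cnt1]
  have h2 := cnt2_swap (fun a (_ : V) => a ∈ U)
  have h3 := cnt2_or_le (fun a (_ : V) => a ∈ U) (fun _ b => b ∈ U)
  simp only [h1] at h2 h3
  rw [h2] at h3
  linarith

lemma exists_of_cnt1_lt {P Q : V → Prop} (h : cnt1 Q < cnt1 P) : ∃ a, P a ∧ ¬ Q a := by
  by_contra! hcon
  exact absurd (cnt1_mono hcon) (not_le.2 h)

lemma exists_of_cnt2_lt {P Q : V → V → Prop} (h : cnt2 Q < cnt2 P) :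
    ∃ a b, P a b ∧ ¬ Q a b := by
  by_contra! hcon
  exact absurd (cnt2_mono hcon) (not_le.2 h)

lemma exists_subset_of_le_cnt1 {P : V → Prop} {t : ℕ} (h : t ≤ cnt1 P) :
    ∃ T : Finset V, #T = t ∧ ∀ u ∈ T, P u := by
  classical
  obtain ⟨T, hT, hc⟩ := exists_subset_card_eq h
  exact ⟨T, hc, fun u hu => by simpa using hT hu⟩

end Counting

section Basic

variable {V : Type*} [Fintype V]

/-- The codegree of a pair of vertices. -/
noncomputable def codeg (H : TSys V) (p q : V) : ℕ := cnt1 (H.E p q)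

lemma codeg_comm (H : TSys V) (p q : V) : codeg H p q = codeg H q p :=
  le_antisymm (cnt1_mono fun _ h => H.swap h) (cnt1_mono fun _ h => H.swap h)

/-- The 3-graph of edges all of whose pairs have codegree at least `k`. -/
def prune (H : TSys V) (k : ℕ) : TSys V where
  E a b c := H.E a b c ∧ k ≤ codeg H a b ∧ k ≤ codeg H b c ∧ k ≤ codeg H a c
  swap h := ⟨H.swap h.1, codeg_comm H _ _ ▸ h.2.1, h.2.2.2, h.2.2.1⟩
  rot h := ⟨H.rot h.1, h.2.2.1, codeg_comm H _ _ ▸ h.2.2.2, codeg_comm H _ _ ▸ h.2.1⟩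
  ne h := H.ne h.1

/-- The 3-graph of edges avoiding the vertices satisfying `R`. -/
def avoid (H : TSys V) (R : V → Prop) : TSys V where
  E a b c := H.E a b c ∧ ¬ R a ∧ ¬ R b ∧ ¬ R c
  swap h := ⟨H.swap h.1, h.2.2.1, h.2.1, h.2.2.2⟩
  rot h := ⟨H.rot h.1, h.2.2.1, h.2.2.2, h.2.1⟩
  ne h := H.ne h.1

lemma cnt3_le_prune (H : TSys V) (k : ℕ) :
    cnt3 H.E ≤ cnt3 (prune H k).E + 3 * k * Fintype.card V ^ 2 := by
  set B : V → V → V → Prop := fun a b c => codeg H a b < k ∧ H.E a b c with hB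
  have hBle : cnt3 B ≤ Fintype.card V ^ 2 * k :=
    (cnt3_and_le (P := fun a b => codeg H a b < k) (R := H.E) fun a b h => h.le).trans
      (Nat.mul_le_mul_right _ (cnt2_le_sq _))
  have h1 : cnt3 H.E ≤ cnt3 (fun a b c => (prune H k).E a b c ∨
      (B a b c ∨ (B b c a ∨ B a c b))) := by
    refine cnt3_mono fun a b c h => ?_
    by_cases h1 : codeg H a b < k
    · exact Or.inr (Or.inl ⟨h1, h⟩)
    by_cases h2 : codeg H b c < k
    · exact Or.inr (Or.inr (Or.inl ⟨h2, H.rot h⟩))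
    by_cases h3 : codeg H a c < k
    · exact Or.inr (Or.inr (Or.inr ⟨h3, H.swap_right h⟩))
    exact Or.inl ⟨h, not_lt.1 h1, not_lt.1 h2, not_lt.1 h3⟩
  have h2 := cnt3_or_le (prune H k).E (fun a b c => (B a b c ∨ (B b c a ∨ B a c b)))
  have h3 := cnt3_or_le B (fun a b c => (B b c a ∨ B a c b))
  have h4 := cnt3_or_le (fun a b c => B b c a) (fun a b c => B a c b)
  have h5 := cnt3_rot B
  have h6 := cnt3_swap_right B
  linarith

lemma cnt3_le_avoid (H : TSys V) (R : V → Prop) :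
    cnt3 H.E ≤ cnt3 (avoid H R).E + 3 * cnt3 (fun a b c => R a ∧ H.E a b c) := by
  set B : V → V → V → Prop := fun a b c => R a ∧ H.E a b c with hB
  have h1 : cnt3 H.E ≤ cnt3 (fun a b c => (avoid H R).E a b c ∨
      (B a b c ∨ (B b c a ∨ B c a b))) := by
    refine cnt3_mono fun a b c h => ?_
    by_cases h1 : R a
    · exact Or.inr (Or.inl ⟨h1, h⟩)
    by_cases h2 : R b
    · exact Or.inr (Or.inr (Or.inl ⟨h2, H.rot h⟩))
    by_cases h3 : R c
    · exact Or.inr (Or.inr (Or.inr ⟨h3, H.rot (H.rot h)⟩))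
    exact Or.inl ⟨h, h1, h2, h3⟩
  have h2 := cnt3_or_le (avoid H R).E (fun a b c => (B a b c ∨ (B b c a ∨ B c a b)))
  have h3 := cnt3_or_le B (fun a b c => (B b c a ∨ B c a b))
  have h4 := cnt3_or_le (fun a b c => B b c a) (fun a b c => B c a b)
  have h5 := cnt3_rot B
  have h6 := cnt3_rot (fun a b c => B b c a)
  linarith

/-- `v` plays the role of the fifth vertex in a copy of `F_5`. -/
def Root (H : TSys V) (v : V) : Prop :=
  ∃ a b c d, a ≠ v ∧ b ≠ v ∧ c ≠ d ∧ H.E a b c ∧ H.E a b d ∧ H.E c d v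

/-- `H` contains no copy of `F_sim(t)`. -/
def FsimFree (H : TSys V) (t : ℕ) : Prop :=
  ∀ (a b c d v p q : V) (T : Finset V), a ≠ v → b ≠ v → c ≠ d →
    p ≠ a → p ≠ b → p ≠ c → p ≠ d → q ≠ a → q ≠ b → q ≠ c → q ≠ d →
    (∀ u ∈ T, u ≠ a ∧ u ≠ b ∧ u ≠ c ∧ u ≠ d ∧ u ≠ v) → #T = t →
    H.E a b c → H.E a b d → H.E c d v → H.E v p q → (∀ u ∈ T, H.E p q u) → False

lemma FsimFree.codeg_lt {H : TSys V} {t : ℕ} (hF : FsimFree H t) {a b c d v p q : V}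
    (hav : a ≠ v) (hbv : b ≠ v) (hcd : c ≠ d) (hc : H.E a b c) (hd : H.E a b d)
    (hv : H.E c d v) (hpq : H.E v p q) (hp : p ≠ a ∧ p ≠ b ∧ p ≠ c ∧ p ≠ d)
    (hq : q ≠ a ∧ q ≠ b ∧ q ≠ c ∧ q ≠ d) : codeg H p q < t + 5 := by
  classical
  by_contra! hcon
  have h1 := cnt1_add_not (H.E p q) (fun u => u ∈ ({a, b, c, d, v} : Finset V))
  have h2 : cnt1 (fun u => H.E p q u ∧ u ∈ ({a, b, c, d, v} : Finset V)) ≤ 5 :=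
    (cnt1_mono fun u h => h.2).trans ((cnt1_mem _).le.trans card_le_five)
  obtain ⟨T, hT, hTu⟩ := exists_subset_of_le_cnt1 (t := t)
    (P := fun u => H.E p q u ∧ ¬ u ∈ ({a, b, c, d, v} : Finset V)) (by
      unfold codeg at hcon; omega)
  refine hF a b c d v p q T hav hbv hcd hp.1 hp.2.1 hp.2.2.1 hp.2.2.2 hq.1 hq.2.1 hq.2.2.1
    hq.2.2.2 (fun u hu => ?_) hT hc hd hv hpq fun u hu => (hTu u hu).1
  simpa using (hTu u hu).2

/-- An `F_sim(t)`-free 3-graph becomes cancellative after removing `O(n ^ 2)` edges. -/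
theorem FsimFree.exists_cancellative {H : TSys V} {t : ℕ} (hF : FsimFree H t) :
    ∃ H' : TSys V, Cancellative H' ∧ (∀ a b c, H'.E a b c → H.E a b c) ∧
      cnt3 H.E ≤ cnt3 H'.E + (3 * t + 48) * Fintype.card V ^ 2 := by
  classical
  set H₁ := avoid (prune H (t + 5)) (Root H) with hH₁
  refine ⟨prune H₁ 3, ?_, fun a b c h => h.1.1.1, ?_⟩
  · intro x y z p q hxy hpx hpy
    have h1 : cnt1 (fun u => u ∈ ({p, q} : Finset V)) < codeg H₁ x y :=
      ((cnt1_mem _).le.trans card_le_two).trans_lt (by have := hxy.2.1; omega)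
    obtain ⟨w, hw, hwpq⟩ := exists_of_cnt1_lt h1
    simp only [mem_insert, mem_singleton, not_or] at hwpq
    exact hw.2.2.2 ⟨p, q, x, y, Ne.symm hwpq.1, Ne.symm hwpq.2, H₁.ne hw, hpx.1.1.1, hpy.1.1.1,
      hw.1.1⟩
  · have h1 := cnt3_le_prune H (t + 5)
    have h2 := cnt3_le_avoid (prune H (t + 5)) (Root H)
    have h3 := cnt3_le_prune H₁ 3
    have h4 : cnt3 (fun a b c => Root H a ∧ (prune H (t + 5)).E a b c) ≤
        Fintype.card V * (8 * Fintype.card V) := by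
      refine (cnt3_and_le_left (k := 8 * Fintype.card V) ?_).trans
        (Nat.mul_le_mul_right _ (cnt1_le_card _))
      rintro v ⟨a, b, c, d, hav, hbv, hcd, hc, hd, hv⟩
      refine (cnt2_mono (Q := fun p q => p ∈ ({a, b, c, d} : Finset V) ∨
        q ∈ ({a, b, c, d} : Finset V)) fun p q hpq => ?_).trans ((cnt2_touch_le _).trans
          (Nat.mul_le_mul_right _ (Nat.mul_le_mul_left 2 (card_le_four (c := c)))))
      by_contra! hcon
      simp only [mem_insert, mem_singleton, not_or] at hcon
      exact absurd (hF.codeg_lt hav hbv hcd hc hd hv hpq.1 hcon.1 hcon.2)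
        (not_lt.2 hpq.2.2.1)
    rw [hH₁] at h3
    nlinarith

end Basic

/-- The colours: `0` marks the exceptional vertices, the others the three parts. -/
abbrev Colour := ZMod 2 × ZMod 2

section Colour

variable {V : Type*} [Fintype V]

/-- The size of a colour class. -/
noncomputable def cs (κ : V → Colour) (c : Colour) : ℕ := cnt1 (fun v => κ v = c)

lemma sum_comp_colour (κ : V → Colour) (f : Colour → ℕ) :
    ∑ v, f (κ v) = ∑ c, cs κ c * f c := by
  classical
  rw [← sum_fiberwise univ κ fun v => f (κ v)]
  refine sum_congr rfl fun c _ => ?_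
  have h : ∑ v with κ v = c, f (κ v) = ∑ v with κ v = c, f c :=
    sum_congr rfl fun v hv => by rw [(mem_filter.1 hv).2]
  rw [h, sum_const, smul_eq_mul, cs, cnt1]
  congr!

open scoped Classical in
lemma cnt1_colour (κ : V → Colour) (φ : Colour → Prop) :
    cnt1 (fun a => φ (κ a)) = ∑ i, cs κ i * (if φ i then 1 else 0) := by
  rw [← sum_comp_colour κ, cnt1, card_filter]

open scoped Classical in
lemma cnt2_colour (κ : V → Colour) (φ : Colour → Colour → Prop) :
    cnt2 (fun a b => φ (κ a) (κ b)) =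
      ∑ i, cs κ i * ∑ j, cs κ j * (if φ i j then 1 else 0) := by
  rw [← sum_comp_colour κ, cnt2_eq_sum]
  exact sum_congr rfl fun a _ => cnt1_colour κ _

open scoped Classical in
lemma cnt3_colour (κ : V → Colour) (φ : Colour → Colour → Colour → Prop) :
    cnt3 (fun a b c => φ (κ a) (κ b) (κ c)) =
      ∑ i, cs κ i * ∑ j, cs κ j * ∑ k, cs κ k * (if φ i j k then 1 else 0) := by
  rw [← sum_comp_colour κ, cnt3_eq_sum]
  exact sum_congr rfl fun a _ => cnt2_colour κ _

lemma sum_colour (f : Colour → ℕ) :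
    ∑ c, f c = f 0 + f (0, 1) + f (1, 0) + f (1, 1) := by
  rw [Fintype.sum_prod_type]
  change ∑ x : Fin 2, ∑ y : Fin 2, f (x, y) = _
  simp only [Fin.sum_univ_two]
  change f (0, 0) + f (0, 1) + (f (1, 0) + f (1, 1)) = _
  rw [← add_assoc]
  rfl

lemma card_eq_sum_cs (κ : V → Colour) :
    Fintype.card V = cs κ 0 + cs κ (0, 1) + cs κ (1, 0) + cs κ (1, 1) := by
  have := sum_comp_colour κ fun _ => 1
  simpa [sum_colour] using this

/-- Two nonzero colours whose sum is the nonzero colour `c`. -/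
def Cross (c i j : Colour) : Prop := i ≠ 0 ∧ j ≠ 0 ∧ c ≠ 0 ∧ i + j = c

instance (c i j : Colour) : Decidable (Cross c i j) := inferInstanceAs (Decidable (_ ∧ _))

lemma cnt3_cross (κ : V → Colour) :
    cnt3 (fun a b c => Cross (κ a) (κ b) (κ c)) =
      6 * (cs κ (0, 1) * cs κ (1, 0) * cs κ (1, 1)) := by
  rw [cnt3_colour κ Cross]
  simp only [sum_colour]
  simp +decide
  ring

lemma cnt2_cross_le (κ : V → Colour) (c : Colour) {s : ℕ} (hs : ∀ c, c ≠ 0 → cs κ c ≤ s) :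
    cnt2 (fun a b => Cross c (κ a) (κ b)) ≤ 2 * s ^ 2 := by
  rw [cnt2_colour κ (Cross c)]
  simp only [sum_colour]
  have h1 := hs (0, 1) (by decide)
  have h2 := hs (1, 0) (by decide)
  have h3 := hs (1, 1) (by decide)
  have h12 := Nat.mul_le_mul h1 h2
  have h13 := Nat.mul_le_mul h1 h3
  have h23 := Nat.mul_le_mul h2 h3
  have : c = 0 ∨ c = (0, 1) ∨ c = (1, 0) ∨ c = (1, 1) := by revert c; decide
  rcases this with rfl | rfl | rfl | rfl <;> simp +decide <;> nlinarith

end Colour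

section Partition

variable {V : Type*} [Fintype V]

/-- The restriction of a 3-graph to a subtype. -/
def restrict (H : TSys V) (S : Finset V) : TSys S where
  E a b c := H.E a b c
  swap h := H.swap h
  rot h := H.rot h
  ne h hab := H.ne h (congrArg _ hab)

lemma cnt2_avoid_le_ld (H : TSys V) (S : Finset V) (v : S) :
    cnt2 ((avoid H (fun u => u ∉ S)).E v) ≤ ld (restrict H S) v := by
  classical
  rw [cnt2, ld]
  refine (card_le_card (t := image (fun x : S × S => ((x.1 : V), (x.2 : V)))
    {x : S × S | (restrict H S).E v x.1 x.2}) ?_).trans card_image_le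
  rintro ⟨p, q⟩ hx
  simp only [mem_filter, mem_univ, true_and] at hx
  obtain ⟨h, -, hp, hq⟩ := hx
  rw [not_not] at hp hq
  exact mem_image.2 ⟨(⟨p, hp⟩, ⟨q, hq⟩), mem_filter.2 ⟨mem_univ _, h⟩, rfl⟩

lemma cube_le_of_colouring {a b c : ℕ} : 27 * (a * b * c) ≤ (a + b + c) ^ 3 := by
  zify
  nlinarith [mul_nonneg (Nat.cast_nonneg (α := ℤ) a) (sq_nonneg ((b : ℤ) - c)),
    mul_nonneg (Nat.cast_nonneg (α := ℤ) b) (sq_nonneg ((a : ℤ) - c)),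
    mul_nonneg (Nat.cast_nonneg (α := ℤ) c) (sq_nonneg ((a : ℤ) - b)),
    mul_nonneg (Nat.cast_nonneg (α := ℤ) a) (sq_nonneg ((a : ℤ) - c)),
    mul_nonneg (Nat.cast_nonneg (α := ℤ) a) (sq_nonneg ((a : ℤ) - b)),
    mul_nonneg (Nat.cast_nonneg (α := ℤ) b) (sq_nonneg ((a : ℤ) - b)),
    mul_nonneg (Nat.cast_nonneg (α := ℤ) b) (sq_nonneg ((b : ℤ) - c)),
    mul_nonneg (Nat.cast_nonneg (α := ℤ) c) (sq_nonneg ((b : ℤ) - c)),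
    mul_nonneg (Nat.cast_nonneg (α := ℤ) c) (sq_nonneg ((a : ℤ) - c))]

/-- A vertex set optimising a weighted edge count induces a 3-graph of large minimum degree. -/
lemma exists_dense_subset (H : TSys V) :
    ∃ S : Finset V, (∀ v ∈ S, 3 * (#S : ℤ) ^ 2 ≤
        14 * cnt2 ((avoid H (fun u => u ∉ S)).E v) + 3 * #S) ∧
      14 * (cnt3 H.E : ℤ) - 3 * (Fintype.card V : ℤ) ^ 3 ≤
        14 * cnt3 (avoid H (fun u => u ∉ S)).E - 3 * (#S : ℤ) ^ 3 := by
  classical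
  obtain ⟨S, -, hS⟩ := exists_max_image (univ : Finset (Finset V))
    (fun S => 14 * (cnt3 (avoid H (fun u => u ∉ S)).E : ℤ) - 3 * (#S : ℤ) ^ 3) ⟨∅, mem_univ _⟩
  refine ⟨S, fun v hv => ?_, ?_⟩
  · have h1 := hS (S.erase v) (mem_univ _)
    have h2 := cnt3_le_avoid (avoid H (fun u => u ∉ S)) (fun u => u = v)
    have h3 : cnt3 (avoid (avoid H (fun u => u ∉ S)) (fun u => u = v)).E ≤
        cnt3 (avoid H (fun u => u ∉ S.erase v)).E := by
      refine cnt3_mono fun a b c h => ?_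
      obtain ⟨⟨h, ha, hb, hc⟩, ha', hb', hc'⟩ := h
      simp only [not_not] at ha hb hc
      exact ⟨h, by simp [*], by simp [*], by simp [*]⟩
    have h4 : cnt3 (fun a b c => a = v ∧ (avoid H (fun u => u ∉ S)).E a b c) ≤
        1 * cnt2 ((avoid H (fun u => u ∉ S)).E v) := by
      have h5 : cnt1 (fun a => a = v) = 1 := by
        simpa using cnt1_mem ({v} : Finset V)
      rw [← h5]
      exact cnt3_and_le_left (P := fun a => a = v) fun a ha => by subst ha; exact le_rfl
    have h5 : (#(S.erase v) : ℤ) = #S - 1 := by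
      rw [card_erase_of_mem hv, Nat.cast_sub (card_pos.2 ⟨v, hv⟩), Nat.cast_one]
    rw [h5] at h1
    zify at h2 h3 h4
    nlinarith
  · have h1 := hS univ (mem_univ _)
    have h2 : cnt3 H.E = cnt3 (avoid H (fun u => u ∉ (univ : Finset V))).E :=
      le_antisymm (cnt3_mono fun a b c h => ⟨h, by simp, by simp, by simp⟩)
        (cnt3_mono fun a b c h => h.1)
    rw [h2, ← card_univ]
    exact h1

/-- The three nonzero colours. -/
def partColour : Fin 3 → Colour := ![(0, 1), (1, 0), (1, 1)]

lemma cross_partColour {i j k : Fin 3} (hij : i ≠ j) (hjk : j ≠ k) (hik : i ≠ k) :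
    Cross (partColour i) (partColour j) (partColour k) := by
  revert i j k; decide

lemma partColour_ne_zero (i : Fin 3) : partColour i ≠ 0 := by
  revert i; decide

lemma sq_sub_le_of_cube {a b c k : ℤ} (ha : 0 ≤ a) (hb : 0 ≤ b) (hc : 0 ≤ c)
    (hpos : 0 < a + b + c) (h : (a + b + c) ^ 3 ≤ 27 * (a * b * c) + (a + b + c) * k) :
    (a - b) ^ 2 ≤ 2 * k := by
  refine le_of_mul_le_mul_left ?_ hpos
  nlinarith [mul_nonneg ha (sq_nonneg (b - c)), mul_nonneg hb (sq_nonneg (a - c)),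
    mul_nonneg hc (sq_nonneg (a - b)), mul_nonneg hpos.le (sq_nonneg (b - c)),
    mul_nonneg hpos.le (sq_nonneg (a - c))]

lemma parts_close {a b c C n : ℕ} (hn : n < 28 * (a + b + c))
    (hC : (10 ^ 8 : ℤ) * (C * n) ≤ n * n)
    (h : (a + b + c : ℤ) ^ 3 * 28 ≤ 28 * 27 * (a * b * c) + C * n ^ 2) :
    5000 * a ≤ 5000 * b + n := by
  have h5 : (n : ℤ) * (C * n) ≤ 28 * (a + b + c) * (C * n) := by
    refine mul_le_mul_of_nonneg_right ?_ (by positivity)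
    omega
  have h3 : ((a : ℤ) - b) ^ 2 ≤ 2 * (C * n) := by
    refine sq_sub_le_of_cube (c := c) (by positivity) (by positivity) (by positivity)
      (by omega) ?_
    linarith
  have h8 : (5000 * ((a : ℤ) - b)) ^ 2 ≤ (n : ℤ) ^ 2 := by
    rw [mul_pow, sq (n : ℤ)]
    have : (0 : ℤ) ≤ n * n := by positivity
    linarith
  have := abs_le_of_sq_le_sq h8 (by positivity)
  zify
  linarith [(abs_le.1 this).2]

/-- A dense `F_sim(t)`-free 3-graph is, up to few vertices and edges, complete tripartite. -/
theorem FsimFree.exists_partition {H : TSys V} {t C : ℕ} (hF : FsimFree H t)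
    (hC : 126 * (3 * t + 48) ≤ C) (hn : 10 ^ 8 * C ≤ Fintype.card V)
    (hE : 2 * Fintype.card V ^ 3 ≤ 9 * cnt3 H.E) :
    ∃ κ : V → Colour, cs κ 0 ≤ C ∧
      (∀ v, κ v ≠ 0 → Fintype.card V ^ 2 ≤
        5 * cnt2 (fun p q => Cross (κ v) (κ p) (κ q) ∧ H.E v p q)) ∧
      cnt3 (fun a b c => Cross (κ a) (κ b) (κ c) ∧ ¬ H.E a b c) ≤ C * Fintype.card V ^ 2 ∧
      ∀ c, c ≠ 0 → 33 * Fintype.card V ≤ 100 * cs κ c ∧ 100 * cs κ c ≤ 34 * Fintype.card V := by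
  classical
  obtain ⟨H', hH', hsub, hcnt⟩ := hF.exists_cancellative
  obtain ⟨S, hSd, hSe⟩ := exists_dense_subset H'
  set n := Fintype.card V with hndef
  set m := #S with hm
  have hmn : m ≤ n := card_le_univ _
  set T := cnt3 (avoid H' (fun u => u ∉ S)).E with hT
  have hn1 : 10 ^ 8 * 126 * 48 ≤ n := by omega
  have hCn : 126 * (3 * t + 48) * n ^ 2 ≤ C * n ^ 2 := Nat.mul_le_mul_right _ hC
  have hkey : 27 * (m : ℤ) ^ 3 + (n : ℤ) ^ 3 ≤ 126 * T + C * n ^ 2 := by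
    zify at hcnt hE hCn
    nlinarith
  have hTm : T ≤ m * (m * m) := by
    have h1 := cnt3_prod (fun a => a ∈ S) (fun b c => b ∈ S ∧ c ∈ S)
    rw [cnt2_prod, cnt1_mem] at h1
    rw [hm, ← h1]
    refine cnt3_mono fun a b c h => ?_
    simpa only [not_not] using h.2
  have hnn : (n : ℤ) ^ 2 * (10 ^ 8 * C) ≤ (n : ℤ) ^ 2 * n := by
    refine mul_le_mul_of_nonneg_left ?_ (sq_nonneg _)
    exact_mod_cast hn
  have hm200 : 200 ≤ m := by
    by_contra! hlt
    have h1 : (m : ℤ) * (m * m) ≤ 200 * (200 * 200) := by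
      exact_mod_cast Nat.mul_le_mul hlt.le (Nat.mul_le_mul hlt.le hlt.le)
    have h2 : (10 ^ 8 : ℤ) * (10 ^ 8 * 10 ^ 8) ≤ n * (n * n) := by
      have : 10 ^ 8 ≤ n := by omega
      exact_mod_cast Nat.mul_le_mul this (Nat.mul_le_mul this this)
    zify at hTm
    nlinarith
  have hcard : Fintype.card S = m := Fintype.card_coe S
  obtain ⟨κ₀, hκ₀⟩ := exists_coloring_of_cancellative (H := restrict H' S)
    (fun x y z p q h1 h2 h3 => hH' _ _ _ _ _ h1 h2 h3) (by rwa [hcard]) (by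
      intro v
      rw [hcard]
      have h1 := hSd v v.2
      have h2 := cnt2_avoid_le_ld H' S v
      zify at h2 ⊢
      linarith)
  set κ : V → Colour := fun v => if h : v ∈ S then partColour (κ₀ ⟨v, h⟩) else 0 with hκ
  have hκ0 : ∀ v, κ v ≠ 0 ↔ v ∈ S := by
    intro v
    by_cases h : v ∈ S
    · simp [hκ, h, partColour_ne_zero]
    · simp [hκ, h]
  have hrain : ∀ a b c, (avoid H' (fun u => u ∉ S)).E a b c → Cross (κ a) (κ b) (κ c) := by
    rintro a b c ⟨h, ha, hb, hc⟩
    rw [not_not] at ha hb hc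
    simp only [hκ, ha, hb, hc, dite_true]
    exact cross_partColour (hκ₀ ⟨a, ha⟩ ⟨b, hb⟩ ⟨c, hc⟩ h) (hκ₀ ⟨b, hb⟩ ⟨c, hc⟩ ⟨a, ha⟩ (H'.rot h))
      (hκ₀ ⟨a, ha⟩ ⟨c, hc⟩ ⟨b, hb⟩ (H'.swap_right h))
  have hsum := card_eq_sum_cs κ
  have hs0 : cs κ 0 + m = n := by
    have h1 := cnt1_add_not (fun _ : V => True) (fun v => κ v = 0)
    have h2 : cnt1 (fun _ : V => True) = n := by simp [cnt1, hndef]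
    have h3 : cnt1 (fun v => True ∧ ¬ κ v = 0) = m := by
      rw [hm, ← cnt1_mem S]
      congr 1
      ext v
      simpa using hκ0 v
    rw [h2, h3] at h1
    simp only [true_and] at h1
    exact h1.symm
  set s₁ := cs κ (0, 1) with hs₁
  set s₂ := cs κ (1, 0) with hs₂
  set s₃ := cs κ (1, 1) with hs₃
  have hms : m = s₁ + s₂ + s₃ := by omega
  have hTle : T + cnt3 (fun a b c => Cross (κ a) (κ b) (κ c) ∧ ¬ H.E a b c) ≤
      6 * (s₁ * s₂ * s₃) := by
    have h := cnt3_add_not (fun a b c => Cross (κ a) (κ b) (κ c)) H.E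
    rw [← cnt3_cross κ, h]
    refine Nat.add_le_add_right (cnt3_mono fun a b c h => ?_) _
    exact ⟨hrain a b c h, hsub _ _ _ h.1⟩
  have hcube := cube_le_of_colouring (a := s₁) (b := s₂) (c := s₃)
  rw [← hms] at hcube
  have hmn3 : (m : ℤ) * m ^ 2 ≤ m * n ^ 2 := by
    exact_mod_cast Nat.mul_le_mul_left _ (Nat.pow_le_pow_left hmn 2)
  have hmC : n ≤ m + C := by
    by_contra! hlt
    have h1 : (m + C + 1 : ℤ) * n ^ 2 ≤ n * n ^ 2 := by
      exact_mod_cast Nat.mul_le_mul_right _ hlt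
    have h2 : (0 : ℤ) < (n : ℤ) ^ 2 := by
      have : 0 < n := by omega
      positivity
    zify at hTle hcube
    nlinarith
  have hm99 : 99 * n ≤ 100 * m := by omega
  refine ⟨κ, by omega, fun v hv => ?_, ?_, ?_⟩
  · have h1 := hSd v ((hκ0 v).1 hv)
    have h2 : cnt2 ((avoid H' (fun u => u ∉ S)).E v) ≤
        cnt2 (fun p q => Cross (κ v) (κ p) (κ q) ∧ H.E v p q) :=
      cnt2_mono fun p q h => ⟨hrain v p q h, hsub _ _ _ h.1⟩
    have h3 : (99 * n : ℤ) * (99 * n) ≤ (100 * m) * (100 * m) := by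
      exact_mod_cast Nat.mul_le_mul hm99 hm99
    have h4 : (10 ^ 8 : ℤ) * n ≤ n * n := by
      have : 10 ^ 8 ≤ n := by omega
      exact_mod_cast Nat.mul_le_mul_right _ this
    zify at h2 ⊢
    nlinarith
  · have h1 : (m : ℤ) * n ^ 2 ≤ n * n ^ 2 := by exact_mod_cast Nat.mul_le_mul_right _ hmn
    have h2 : (0 : ℤ) ≤ C * n ^ 2 := by positivity
    zify at hTle hcube ⊢
    linarith
  · have hCn1 : (10 ^ 8 : ℤ) * (C * n) ≤ n * n := by
      have := Nat.mul_le_mul_right n hn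
      zify at this
      linarith
    have hms3 : (m : ℤ) ^ 3 * 28 ≤ 28 * 27 * (s₁ * s₂ * s₃) + C * n ^ 2 := by
      have h7 : (m : ℤ) * m ^ 2 ≤ n * n ^ 2 := by
        exact_mod_cast Nat.mul_le_mul hmn (Nat.pow_le_pow_left hmn 2)
      zify at hTle
      linarith
    have hdiff : ∀ a b c : ℕ, m = a + b + c → s₁ * s₂ * s₃ = a * b * c →
        5000 * a ≤ 5000 * b + n := by
      intro a b c h1 h2
      refine parts_close (c := c) (C := C) (by omega) hCn1 ?_
      have h4 : (m : ℤ) = a + b + c := by exact_mod_cast h1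
      have h6 : ((s₁ : ℤ) * s₂ * s₃) = a * b * c := by exact_mod_cast h2
      rwa [← h4, ← h6]
    have h12 := hdiff s₁ s₂ s₃ (by omega) rfl
    have h21 := hdiff s₂ s₁ s₃ (by omega) (by ring)
    have h13 := hdiff s₁ s₃ s₂ (by omega) (by ring)
    have h31 := hdiff s₃ s₁ s₂ (by omega) (by ring)
    have h23 := hdiff s₂ s₃ s₁ (by omega) (by ring)
    have h32 := hdiff s₃ s₂ s₁ (by omega) (by ring)
    intro c hc
    have : c = (0, 1) ∨ c = (1, 0) ∨ c = (1, 1) := by revert c; decide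
    rcases this with rfl | rfl | rfl
    · rw [← hs₁]; omega
    · rw [← hs₂]; omega
    · rw [← hs₃]; omega

end Partition

/-- The vertices `p` and `q` lie in different parts. -/
def Apart {V : Type*} (κ : V → Colour) (p q : V) : Prop := κ p ≠ 0 ∧ κ q ≠ 0 ∧ κ p ≠ κ q

/-- The vertices `p` and `q` lie in the same part. -/
def Same {V : Type*} (κ : V → Colour) (p q : V) : Prop := κ p ≠ 0 ∧ κ p = κ q

lemma Cross.apart {V : Type*} {κ : V → Colour} {c : Colour} {p q : V} (h : Cross c (κ p) (κ q)) :
    Apart κ p q := by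
  obtain ⟨h1, h2, h3, h4⟩ := h
  refine ⟨h1, h2, fun h => h3 ?_⟩
  rw [← h4, h]
  exact (by decide : ∀ c : Colour, c + c = 0) _

lemma Apart.add_ne_zero {V : Type*} {κ : V → Colour} {p q : V} (h : Apart κ p q) : κ p + κ q ≠ 0 := by
  obtain ⟨h1, h2, h3⟩ := h
  revert h1 h2 h3
  generalize κ p = i
  generalize κ q = j
  revert i j; decide

lemma cross_iff_of_apart {V : Type*} {κ : V → Colour} {p q : V} (h : Apart κ p q) (k : Colour) :
    Cross (κ p) (κ q) k ↔ k = κ p + κ q := by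
  obtain ⟨h1, h2, h3⟩ := h
  revert h1 h2 h3
  generalize κ p = i
  generalize κ q = j
  revert i j k; decide

section Structure

variable {V : Type*} [Fintype V]

lemma exists_common {P Q R : V → V → Prop} (U : Finset V) (hP : ∀ a b, P a b → R a b)
    (hQ : ∀ a b, Q a b → R a b)
    (h : cnt2 R + 2 * #U * Fintype.card V < cnt2 P + cnt2 Q) :
    ∃ a b, P a b ∧ Q a b ∧ a ∉ U ∧ b ∉ U := by
  have h1 := cnt2_add_not P Q
  have h2 := cnt2_add_not R Q
  have h3 : cnt2 (fun a b => P a b ∧ ¬ Q a b) ≤ cnt2 (fun a b => R a b ∧ ¬ Q a b) :=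
    cnt2_mono fun a b h => ⟨hP _ _ h.1, h.2⟩
  have h4 : cnt2 Q ≤ cnt2 (fun a b => R a b ∧ Q a b) := cnt2_mono fun a b h => ⟨hQ _ _ h, h⟩
  have h5 := cnt2_touch_le U
  obtain ⟨a, b, ⟨hp, hq⟩, hab⟩ := exists_of_cnt2_lt
    (P := fun a b => P a b ∧ Q a b) (Q := fun a b => a ∈ U ∨ b ∈ U) (by omega)
  rw [not_or] at hab
  exact ⟨a, b, hp, hq, hab⟩

/-- `H` is close to the complete tripartite 3-graph on the nonzero colour classes of `κ`. -/
structure Near (H : TSys V) (κ : V → Colour) (t C : ℕ) : Prop where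
  free : FsimFree H t
  t_pos : 1 ≤ t
  le_C : 126 * (3 * t + 48) ≤ C
  big : 10 ^ 8 * C ^ 3 ≤ Fintype.card V
  zero : cs κ 0 ≤ C
  deg : ∀ v, κ v ≠ 0 → Fintype.card V ^ 2 ≤
    5 * cnt2 (fun p q => Cross (κ v) (κ p) (κ q) ∧ H.E v p q)
  miss : cnt3 (fun a b c => Cross (κ a) (κ b) (κ c) ∧ ¬ H.E a b c) ≤ C * Fintype.card V ^ 2
  le_size : ∀ c, c ≠ 0 → 33 * Fintype.card V ≤ 100 * cs κ c
  size_le : ∀ c, c ≠ 0 → 100 * cs κ c ≤ 34 * Fintype.card V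

/-- A pair of vertices in different parts contained in many missing edges. -/
def Poor (H : TSys V) (κ : V → Colour) (C : ℕ) (p q : V) : Prop :=
  Apart κ p q ∧ Fintype.card V <
    1000 * C * cnt1 (fun r => Cross (κ p) (κ q) (κ r) ∧ ¬ H.E p q r)

lemma cross_of_ne {i j k : Colour} (hi : i ≠ 0) (hj : j ≠ 0) (hk : k ≠ 0) (hij : i ≠ j)
    (hjk : j ≠ k) (hik : i ≠ k) : Cross i j k := by
  have : ∀ i j k : Colour, (i ≠ 0 ∧ j ≠ 0 ∧ k ≠ 0 ∧ i ≠ j ∧ j ≠ k ∧ i ≠ k) → Cross i j k := by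
    decide
  exact this i j k ⟨hi, hj, hk, hij, hjk, hik⟩

variable {H : TSys V} {κ : V → Colour} {t C : ℕ}

namespace Near

lemma C_pos (h : Near H κ t C) : 6000 ≤ C := by have := h.le_C; omega

lemma mul_le (h : Near H κ t C) : 10 ^ 8 * C ^ 3 * Fintype.card V ≤ Fintype.card V ^ 2 := by
  rw [sq]; exact Nat.mul_le_mul_right _ h.big

lemma C_sq_le (h : Near H κ t C) : 6000 * C ^ 2 ≤ C ^ 3 := by
  rw [pow_succ C 2, mul_comm]
  exact Nat.mul_le_mul_left _ h.C_pos

lemma C_le (h : Near H κ t C) : 6000 * C ≤ C ^ 2 := by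
  rw [sq]; exact Nat.mul_le_mul_right _ h.C_pos

lemma card_pos (h : Near H κ t C) : 0 < Fintype.card V := by
  have := h.big
  have := h.C_sq_le
  have := h.C_le
  have := h.C_pos
  omega

lemma C_sq_mul_le (h : Near H κ t C) : 10 ^ 11 * C ^ 2 * Fintype.card V ≤ Fintype.card V ^ 2 := by
  refine le_trans (Nat.mul_le_mul_right _ ?_) h.mul_le
  have := h.C_sq_le
  omega

lemma C_mul_le (h : Near H κ t C) : 10 ^ 14 * C * Fintype.card V ≤ Fintype.card V ^ 2 := by
  refine le_trans (Nat.mul_le_mul_right _ ?_) h.C_sq_mul_le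
  have := h.C_le
  omega

lemma one_mul_le (h : Near H κ t C) : 10 ^ 17 * Fintype.card V ≤ Fintype.card V ^ 2 := by
  refine le_trans (Nat.mul_le_mul_right _ ?_) h.C_mul_le
  have := h.C_pos
  omega

lemma sq_pos (h : Near H κ t C) : 0 < Fintype.card V ^ 2 := pow_pos h.card_pos 2

lemma cnt2_poor_le (h : Near H κ t C) :
    cnt2 (Poor H κ C) ≤ 2000 * C ^ 2 * Fintype.card V := by
  set n := Fintype.card V with hn
  have h1 := le_cnt3_and (P := Poor H κ C)
    (R := fun p q r => Cross (κ p) (κ q) (κ r) ∧ ¬ H.E p q r) (k := n / (1000 * C)) (by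
      intro p q hpq
      refine Nat.div_le_of_le_mul ?_
      exact hpq.2.le)
  have h2 := (h1.trans (cnt3_mono fun a b c h => h.2)).trans h.miss
  have h3 := h.big
  have h4 := h.C_sq_le
  have h5 := h.C_le
  have h6 := h.C_pos
  have h7 : n ≤ 2000 * C * (n / (1000 * C)) := by
    have h8 := Nat.div_add_mod n (1000 * C)
    have h9 := Nat.mod_lt n (y := 1000 * C) (by omega)
    have h10 : 2000 * C * (n / (1000 * C)) = 2 * (1000 * C * (n / (1000 * C))) := by ring
    omega
  have hn0 : 0 < n := by omega
  refine Nat.le_of_mul_le_mul_right ?_ hn0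
  calc cnt2 (Poor H κ C) * n ≤ cnt2 (Poor H κ C) * (2000 * C * (n / (1000 * C))) :=
        Nat.mul_le_mul_left _ h7
    _ = 2000 * C * (cnt2 (Poor H κ C) * (n / (1000 * C))) := by ring
    _ ≤ 2000 * C * (C * n ^ 2) := Nat.mul_le_mul_left _ h2
    _ = _ := by ring

lemma codeg_le_of_not_poor (h : Near H κ t C) {p q : V} (hpq : Apart κ p q)
    (hP : ¬ Poor H κ C p q) : t + 5 ≤ codeg H p q := by
  have h1 : 1000 * C * cnt1 (fun r => Cross (κ p) (κ q) (κ r) ∧ ¬ H.E p q r) ≤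
      Fintype.card V := by
    by_contra! hcon
    exact hP ⟨hpq, hcon⟩
  have h2 := cnt1_add_not (fun r => Cross (κ p) (κ q) (κ r)) (H.E p q)
  have h3 : cnt1 (fun r => Cross (κ p) (κ q) (κ r)) = cs κ (κ p + κ q) := by
    rw [cs]
    congr 1
    ext r
    exact cross_iff_of_apart hpq _
  have h4 := h.le_size _ hpq.add_ne_zero
  have h5 : cnt1 (fun r => Cross (κ p) (κ q) (κ r) ∧ H.E p q r) ≤ codeg H p q :=
    cnt1_mono fun r h => h.2
  have h6 := h.C_pos
  have h7 := h.big
  have h8 := h.C_sq_le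
  have h9 := h.C_le
  have h10 := h.le_C
  have h11 : 1000 * cnt1 (fun r => Cross (κ p) (κ q) (κ r) ∧ ¬ H.E p q r) ≤
      1000 * C * cnt1 (fun r => Cross (κ p) (κ q) (κ r) ∧ ¬ H.E p q r) :=
    Nat.mul_le_mul_right _ (by omega)
  omega

/-- The link of a root contains few pairs of vertices from different parts. -/
lemma cnt2_apart_le_of_root (h : Near H κ t C) {v : V} (hv : Root H v) :
    cnt2 (fun p q => Apart κ p q ∧ H.E v p q) ≤ (2000 * C ^ 2 + 8) * Fintype.card V := by
  classical
  obtain ⟨a, b, c, d, hav, hbv, hcd, hc, hd, hv⟩ := hv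
  by_contra! hcon
  have h1 := h.cnt2_poor_le
  have h2 := cnt2_touch_le ({a, b, c, d} : Finset V)
  have h3 : 2 * #({a, b, c, d} : Finset V) * Fintype.card V ≤ 2 * 4 * Fintype.card V :=
    Nat.mul_le_mul_right _ (Nat.mul_le_mul_left _ card_le_four)
  have h4 := cnt2_or_le (Poor H κ C)
    (fun p q => p ∈ ({a, b, c, d} : Finset V) ∨ q ∈ ({a, b, c, d} : Finset V))
  obtain ⟨p, q, ⟨hpq, hE⟩, hP⟩ := exists_of_cnt2_lt
    (lt_of_le_of_lt (h4.trans (by linarith)) hcon)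
  simp only [not_or, mem_insert, mem_singleton] at hP
  have h5 := h.free.codeg_lt hav hbv hcd hc hd hv hE hP.2.1 hP.2.2
  have h6 := h.codeg_le_of_not_poor hpq hP.1
  omega

lemma not_root_of_cross (h : Near H κ t C) {v : V} {c : Colour}
    (hv : 9 * Fintype.card V ^ 2 ≤ 50 * cnt2 (fun p q => Cross c (κ p) (κ q) ∧ H.E v p q)) :
    ¬ Root H v := by
  intro hr
  have h1 := h.cnt2_apart_le_of_root hr
  have h2 : cnt2 (fun p q => Cross c (κ p) (κ q) ∧ H.E v p q) ≤
      cnt2 (fun p q => Apart κ p q ∧ H.E v p q) := cnt2_mono fun p q h => ⟨h.1.apart, h.2⟩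
  have h3 := h.C_sq_mul_le
  have h4 := h.one_mul_le
  have h5 := h.sq_pos
  linarith

lemma deg' (h : Near H κ t C) {v : V} (hv : κ v ≠ 0) : 9 * Fintype.card V ^ 2 ≤
    50 * cnt2 (fun p q => Cross (κ v) (κ p) (κ q) ∧ H.E v p q) := by
  have := h.deg v hv
  omega

/-- Two vertices with large links in the same pair of parts have a common link pair. -/
lemma exists_common_link (h : Near H κ t C) {p q : V} {c : Colour} (U : Finset V)
    (hU : #U ≤ C)
    (hp : 9 * Fintype.card V ^ 2 ≤ 50 * cnt2 (fun a b => Cross c (κ a) (κ b) ∧ H.E p a b))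
    (hq : 9 * Fintype.card V ^ 2 ≤ 50 * cnt2 (fun a b => Cross c (κ a) (κ b) ∧ H.E q a b)) :
    ∃ a b, H.E a b p ∧ H.E a b q ∧ a ∉ U ∧ b ∉ U := by
  have h1 : cnt2 (fun a b => Cross c (κ a) (κ b)) ≤ 2 * (34 * Fintype.card V / 100) ^ 2 :=
    cnt2_cross_le κ c fun c hc => by have := h.size_le c hc; omega
  have h2 : (100 * (34 * Fintype.card V / 100)) ^ 2 ≤ (34 * Fintype.card V) ^ 2 :=
    Nat.pow_le_pow_left (Nat.mul_div_le _ _) 2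
  have h3 : #U * Fintype.card V ≤ C * Fintype.card V := Nat.mul_le_mul_right _ hU
  have h4 := h.C_mul_le
  have h5 := h.sq_pos
  obtain ⟨a, b, ha, hb, hab⟩ := exists_common (R := fun a b => Cross c (κ a) (κ b)) U
    (P := fun a b => Cross c (κ a) (κ b) ∧ H.E p a b)
    (Q := fun a b => Cross c (κ a) (κ b) ∧ H.E q a b) (fun a b h => h.1) (fun a b h => h.1)
    (by nlinarith)
  exact ⟨a, b, H.rot ha.2, H.rot hb.2, hab⟩

lemma not_root (h : Near H κ t C) {v : V} (hv : κ v ≠ 0) : ¬ Root H v :=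
  h.not_root_of_cross (h.deg' hv)

/-- An edge containing two vertices of the same part makes its third vertex a root. -/
lemma root_of_same (h : Near H κ t C) {p q v : V} (hpq : Same κ p q) (hE : H.E p q v) :
    Root H v := by
  obtain ⟨a, b, ha, hb, hau, hbu⟩ := h.exists_common_link {v} (by have := h.C_pos; simp; omega)
    (h.deg' hpq.1) (hpq.2 ▸ h.deg' (hpq.2 ▸ hpq.1 : κ q ≠ 0))
  rw [mem_singleton] at hau hbu
  exact ⟨a, b, p, q, hau, hbu, H.ne hE, ha, hb, hE⟩

lemma cross_of_edge (h : Near H κ t C) {a b c : V} (hE : H.E a b c) (ha : κ a ≠ 0)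
    (hb : κ b ≠ 0) (hc : κ c ≠ 0) : Cross (κ a) (κ b) (κ c) := by
  refine cross_of_ne ha hb hc (fun hab => ?_) (fun hbc => ?_) (fun hac => ?_)
  · exact h.not_root hc (h.root_of_same ⟨ha, hab⟩ hE)
  · exact h.not_root ha (h.root_of_same ⟨hb, hbc⟩ (H.rot hE))
  · exact h.not_root hb (h.root_of_same ⟨ha, hac⟩ (H.swap_right hE))

end Near

end Structure

section Trichotomy

variable {V : Type*} [Fintype V] {H : TSys V} {κ : V → Colour} {t C : ℕ}

/-- The number of link pairs of `w` inside a part. -/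
noncomputable def sameCnt (H : TSys V) (κ : V → Colour) (w : V) : ℕ :=
  cnt2 fun p q => Same κ p q ∧ H.E w p q

/-- The number of link pairs of `w` between the two parts other than `c`. -/
noncomputable def crossCnt (H : TSys V) (κ : V → Colour) (c : Colour) (w : V) : ℕ :=
  cnt2 fun p q => Cross c (κ p) (κ q) ∧ H.E w p q

/-- The number of link pairs of `w` inside the union of the parts. -/
noncomputable def insideCnt (H : TSys V) (κ : V → Colour) (w : V) : ℕ :=
  cnt2 fun p q => (κ p ≠ 0 ∧ κ q ≠ 0) ∧ H.E w p q

namespace Near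

/-- If the link of `x` has many pairs inside parts, `x` is the fifth vertex of a copy of `F_5`
avoiding a given small set. -/
lemma exists_F5 (h : Near H κ t C) {x : V} (hx : Fintype.card V ^ 2 ≤ 50 * sameCnt H κ x)
    (U : Finset V) (hU : #U ≤ t + 3) :
    ∃ a b c d, (a ∉ U ∧ b ∉ U ∧ c ∉ U ∧ d ∉ U) ∧ a ≠ x ∧ b ≠ x ∧ c ≠ d ∧
      H.E a b c ∧ H.E a b d ∧ H.E c d x := by
  classical
  have h0 := h.le_C
  have h1 : #U * Fintype.card V ≤ C * Fintype.card V := Nat.mul_le_mul_right _ (by omega)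
  have h2 := cnt2_touch_le U
  have h3 := h.C_mul_le
  have h4 := h.sq_pos
  obtain ⟨c, d, ⟨hcd, hE⟩, hU'⟩ := exists_of_cnt2_lt
    (P := fun p q => Same κ p q ∧ H.E x p q) (Q := fun a b => a ∈ U ∨ b ∈ U)
    (by unfold sameCnt at hx; linarith)
  rw [not_or] at hU'
  obtain ⟨a, b, ha, hb, hau, hbu⟩ := h.exists_common_link (insert x U)
    ((card_insert_le _ _).trans (by omega))
    (h.deg' hcd.1) (hcd.2 ▸ h.deg' (hcd.2 ▸ hcd.1 : κ d ≠ 0))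
  rw [mem_insert, not_or] at hau hbu
  exact ⟨a, b, c, d, ⟨hau.2, hbu.2, hU'⟩, hau.1, hbu.1, H.ne_right hE, ha, hb, H.rot hE⟩

/-- An edge through such a vertex `x` has small opposite codegree. -/
lemma codeg_le_of_edge (h : Near H κ t C) {x p q : V}
    (hx : Fintype.card V ^ 2 ≤ 50 * sameCnt H κ x) (hE : H.E x p q) : codeg H p q ≤ t := by
  classical
  by_contra! hcon
  have h1 := cnt1_add_not (H.E p q) (fun u => u ∈ ({x} : Finset V))
  have h2 : cnt1 (fun u => H.E p q u ∧ u ∈ ({x} : Finset V)) ≤ 1 :=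
    (cnt1_mono fun u h => h.2).trans ((cnt1_mem _).le.trans (card_singleton _).le)
  obtain ⟨T, hT, hTu⟩ := exists_subset_of_le_cnt1 (t := t)
    (P := fun u => H.E p q u ∧ ¬ u ∈ ({x} : Finset V)) (by unfold codeg at hcon; omega)
  obtain ⟨a, b, c, d, ⟨ha, hb, hc, hd⟩, hax, hbx, hcd, hac, had, hv⟩ :=
    h.exists_F5 hx (insert p (insert q T))
      ((card_insert_le _ _).trans (by have := card_insert_le q T; omega))
  simp only [mem_insert, not_or] at ha hb hc hd
  refine h.free a b c d x p q T hax hbx hcd (Ne.symm ha.1) (Ne.symm hb.1) (Ne.symm hc.1)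
    (Ne.symm hd.1) (Ne.symm ha.2.1) (Ne.symm hb.2.1) (Ne.symm hc.2.1) (Ne.symm hd.2.1)
    (fun u hu => ⟨?_, ?_, ?_, ?_, ?_⟩) hT hac had hv hE fun u hu => (hTu u hu).1
  · rintro rfl; exact ha.2.2 hu
  · rintro rfl; exact hb.2.2 hu
  · rintro rfl; exact hc.2.2 hu
  · rintro rfl; exact hd.2.2 hu
  · simpa using (hTu u hu).2

lemma cnt1_same_le (h : Near H κ t C) (p q : V) :
    cnt1 (fun w => Fintype.card V ^ 2 ≤ 50 * sameCnt H κ w ∧ H.E w p q) ≤ t := by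
  by_cases hex : ∃ x, Fintype.card V ^ 2 ≤ 50 * sameCnt H κ x ∧ H.E x p q
  · obtain ⟨x, hx, hE⟩ := hex
    exact (cnt1_mono fun u hu => H.rot hu.2).trans (h.codeg_le_of_edge hx hE)
  · have : cnt1 (fun w => Fintype.card V ^ 2 ≤ 50 * sameCnt H κ w ∧ H.E w p q) ≤
        cnt1 (fun w => w ∈ (∅ : Finset V)) := cnt1_mono fun w hw => absurd ⟨w, hw⟩ hex
    rw [cnt1_mem] at this
    simp at this
    omega

lemma cnt2_third_le (h : Near H κ t C) {w p q : V} (hpq : Apart κ p q)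
    (hP : ¬ Poor H κ C p q) (hE : H.E w p q) :
    1000 * C * cnt2 (fun r s => κ r = κ p + κ q ∧ κ s ≠ 0 ∧ H.E w r s) ≤
      (2000 * C + Fintype.card V) * Fintype.card V := by
  classical
  have h1 : cnt2 (fun r s => κ r = κ p + κ q ∧ κ s ≠ 0 ∧ H.E w r s) ≤
      cnt2 (fun r s => (H.E p q r ∧ (κ s ≠ 0 ∧ H.E w r s)) ∨
        ((Cross (κ p) (κ q) (κ r) ∧ ¬ H.E p q r) ∧ (κ s ≠ 0 ∧ H.E w r s))) := by
    refine cnt2_mono fun r s hrs => ?_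
    by_cases hr : H.E p q r
    · exact Or.inl ⟨hr, hrs.2⟩
    · exact Or.inr ⟨⟨(cross_iff_of_apart hpq _).2 hrs.1, hr⟩, hrs.2⟩
  have h2 : cnt2 (fun r s => H.E p q r ∧ (κ s ≠ 0 ∧ H.E w r s)) ≤ codeg H p q * 2 := by
    refine cnt2_and_le fun r hr => ?_
    refine (cnt1_mono (Q := fun s => s ∈ ({p, q} : Finset V)) fun s hs => ?_).trans
      ((cnt1_mem _).le.trans card_le_two)
    by_contra! hcon
    simp only [mem_insert, mem_singleton, not_or] at hcon
    exact h.not_root hs.1 ⟨p, q, w, r, Ne.symm hcon.1, Ne.symm hcon.2, H.ne hs.2, H.rot hE, hr,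
      hs.2⟩
  have h3 : cnt2 (fun r s => (Cross (κ p) (κ q) (κ r) ∧ ¬ H.E p q r) ∧
      (κ s ≠ 0 ∧ H.E w r s)) ≤
      cnt1 (fun r => Cross (κ p) (κ q) (κ r) ∧ ¬ H.E p q r) * Fintype.card V :=
    cnt2_and_le fun r hr => cnt1_le_card _
  have h4 := cnt2_or_le (fun r s => H.E p q r ∧ (κ s ≠ 0 ∧ H.E w r s))
    (fun r s => (Cross (κ p) (κ q) (κ r) ∧ ¬ H.E p q r) ∧ (κ s ≠ 0 ∧ H.E w r s))
  have h5 : 1000 * C * cnt1 (fun r => Cross (κ p) (κ q) (κ r) ∧ ¬ H.E p q r) ≤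
      Fintype.card V := by
    by_contra! hcon
    exact hP ⟨hpq, hcon⟩
  have h6 : codeg H p q ≤ Fintype.card V := cnt1_le_card _
  calc _ ≤ 1000 * C * (Fintype.card V * 2 +
        cnt1 (fun r => Cross (κ p) (κ q) (κ r) ∧ ¬ H.E p q r) * Fintype.card V) :=
        Nat.mul_le_mul_left _ (by omega)
    _ = 2000 * C * Fintype.card V + (1000 * C *
        cnt1 (fun r => Cross (κ p) (κ q) (κ r) ∧ ¬ H.E p q r)) * Fintype.card V := by ring
    _ ≤ 2000 * C * Fintype.card V + Fintype.card V * Fintype.card V := by gcongr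
    _ = _ := by ring

lemma inside_le (h : Near H κ t C) {w p q : V} (hpq : Same κ p q) (hE : H.E w p q) :
    insideCnt H κ w ≤ sameCnt H κ w + (2000 * C ^ 2 + 8) * Fintype.card V := by
  refine ((cnt2_mono fun p q hpq => ?_).trans (cnt2_or_le _ _)).trans
    (Nat.add_le_add_left (h.cnt2_apart_le_of_root (h.root_of_same hpq (H.rot hE))) _)
  by_cases hs : κ p = κ q
  · exact Or.inl ⟨⟨hpq.1.1, hs⟩, hpq.2⟩
  · exact Or.inr ⟨⟨hpq.1.1, hpq.1.2, hs⟩, hpq.2⟩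

lemma inside_le_of_same (h : Near H κ t C) {w : V}
    (hw : Fintype.card V ^ 2 ≤ 50 * sameCnt H κ w) :
    insideCnt H κ w ≤ sameCnt H κ w + (2000 * C ^ 2 + 8) * Fintype.card V := by
  have h1 := h.sq_pos
  obtain ⟨p, q, hpq, -⟩ := exists_of_cnt2_lt (P := fun p q => Same κ p q ∧ H.E w p q)
    (Q := fun p q => p ∈ (∅ : Finset V) ∨ q ∈ (∅ : Finset V)) (by
      have h2 := cnt2_touch_le (∅ : Finset V)
      unfold sameCnt at hw
      simp only [card_empty] at h2
      omega)
  exact h.inside_le hpq.1 hpq.2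

/-- The link of an arbitrary vertex consists mostly of pairs inside parts, or mostly of pairs
between two fixed parts, or it is small. -/
lemma trichotomy (h : Near H κ t C) (w : V) :
    Fintype.card V ^ 2 ≤ 50 * sameCnt H κ w ∨
    (∃ c, c ≠ 0 ∧ 9 * Fintype.card V ^ 2 ≤ 50 * crossCnt H κ c w ∧
      1000 * C * insideCnt H κ w ≤ 1000 * C * crossCnt H κ c w +
        2 * (2000 * C + Fintype.card V) * Fintype.card V) ∨
    5 * insideCnt H κ w ≤ Fintype.card V ^ 2 := by
  classical
  have h0 : insideCnt H κ w ≤ sameCnt H κ w + cnt2 (fun p q => Apart κ p q ∧ H.E w p q) := by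
    refine (cnt2_mono fun p q hpq => ?_).trans (cnt2_or_le _ _)
    by_cases hs : κ p = κ q
    · exact Or.inl ⟨⟨hpq.1.1, hs⟩, hpq.2⟩
    · exact Or.inr ⟨⟨hpq.1.1, hpq.1.2, hs⟩, hpq.2⟩
  have hm1 := h.C_sq_mul_le
  have hm2 := h.one_mul_le
  have hm3 := h.sq_pos
  by_cases hsame : ∃ p q, Same κ p q ∧ H.E w p q
  · obtain ⟨p, q, hpq, hE⟩ := hsame
    have h1 := h.inside_le hpq hE
    by_cases h2 : Fintype.card V ^ 2 ≤ 50 * sameCnt H κ w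
    · exact Or.inl h2
    · refine Or.inr (Or.inr ?_)
      nlinarith
  have h1 : sameCnt H κ w = 0 := by
    have : sameCnt H κ w ≤ cnt2 (fun p q => p ∈ (∅ : Finset V) ∨ q ∈ (∅ : Finset V)) :=
      cnt2_mono fun p q hpq => absurd ⟨p, q, hpq⟩ hsame
    have := this.trans (cnt2_touch_le _)
    simpa using this
  by_cases hpoor : ∃ p q, (Apart κ p q ∧ H.E w p q) ∧ ¬ Poor H κ C p q
  · obtain ⟨p, q, ⟨hpq, hE⟩, hP⟩ := hpoor
    have h2 := h.cnt2_third_le hpq hP hE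
    set B : V → V → Prop := fun r s => κ r = κ p + κ q ∧ κ s ≠ 0 ∧ H.E w r s with hB
    have h3 : insideCnt H κ w ≤ cnt2 (fun r s => (Cross (κ p + κ q) (κ r) (κ s) ∧ H.E w r s) ∨
        (B r s ∨ B s r)) := by
      refine cnt2_mono fun r s hrs => ?_
      by_cases hr : κ r = κ p + κ q
      · exact Or.inr (Or.inl ⟨hr, hrs.1.2, hrs.2⟩)
      by_cases hs : κ s = κ p + κ q
      · exact Or.inr (Or.inr ⟨hs, hrs.1.1, H.swap_right hrs.2⟩)
      refine Or.inl ⟨cross_of_ne hpq.add_ne_zero hrs.1.1 hrs.1.2 (Ne.symm hr) (fun hrs' => ?_)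
        (Ne.symm hs), hrs.2⟩
      exact hsame ⟨r, s, ⟨hrs.1.1, hrs'⟩, hrs.2⟩
    have h4 := cnt2_or_le (fun r s => Cross (κ p + κ q) (κ r) (κ s) ∧ H.E w r s)
      (fun r s => B r s ∨ B s r)
    have h5 := cnt2_or_le B (fun r s => B s r)
    rw [cnt2_swap B] at h5
    have h6 : insideCnt H κ w ≤ crossCnt H κ (κ p + κ q) w + 2 * cnt2 B := by
      unfold crossCnt
      omega
    have h7 : 1000 * C * insideCnt H κ w ≤
        1000 * C * (crossCnt H κ (κ p + κ q) w + 2 * cnt2 B) := Nat.mul_le_mul_left _ h6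
    by_cases h8 : 9 * Fintype.card V ^ 2 ≤ 50 * crossCnt H κ (κ p + κ q) w
    · exact Or.inr (Or.inl ⟨_, hpq.add_ne_zero, h8, by linarith⟩)
    · refine Or.inr (Or.inr ?_)
      have h9 := h.C_pos
      have h10 : 6000 * cnt2 B ≤ C * cnt2 B := Nat.mul_le_mul_right _ h9
      have h11 := h.C_mul_le
      have h12 : 1000 * (6000 * cnt2 B) ≤ (2000 * C + Fintype.card V) * Fintype.card V := by
        linarith
      nlinarith
  · refine Or.inr (Or.inr ?_)
    have h2 : cnt2 (fun p q => Apart κ p q ∧ H.E w p q) ≤ cnt2 (Poor H κ C) := by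
      refine cnt2_mono fun p q hpq => ?_
      by_contra hcon
      exact hpoor ⟨p, q, hpq, hcon⟩
    have h3 := h.cnt2_poor_le
    nlinarith

end Near

end Trichotomy

section Classification

variable {V : Type*} [Fintype V] {H : TSys V} {κ : V → Colour} {t C : ℕ}

lemma cnt2_same (κ : V → Colour) :
    cnt2 (Same κ) = cs κ (0, 1) ^ 2 + cs κ (1, 0) ^ 2 + cs κ (1, 1) ^ 2 := by
  have := cnt2_colour κ fun i j => i ≠ 0 ∧ i = j
  simp only [sum_colour] at this
  change cnt2 (Same κ) = _ at this
  rw [this]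
  simp +decide
  ring

lemma cnt2_cross_eq (κ : V → Colour) :
    cnt2 (fun p q => Cross (0, 1) (κ p) (κ q)) = 2 * (cs κ (1, 0) * cs κ (1, 1)) ∧
    cnt2 (fun p q => Cross (1, 0) (κ p) (κ q)) = 2 * (cs κ (0, 1) * cs κ (1, 1)) ∧
    cnt2 (fun p q => Cross (1, 1) (κ p) (κ q)) = 2 * (cs κ (0, 1) * cs κ (1, 0)) := by
  refine ⟨?_, ?_, ?_⟩
  · rw [cnt2_colour κ (Cross (0, 1))]
    simp only [sum_colour]
    simp +decide
    ring
  · rw [cnt2_colour κ (Cross (1, 0))]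
    simp only [sum_colour]
    simp +decide
    ring
  · rw [cnt2_colour κ (Cross (1, 1))]
    simp only [sum_colour]
    simp +decide
    ring

/-- Moving exceptional vertices into the parts accounts for their cross link pairs. -/
lemma cnt3_cross_extend (κ g : V → Colour) (hg : ∀ v, κ v ≠ 0 → g v = κ v) :
    6 * (cs κ (0, 1) * cs κ (1, 0) * cs κ (1, 1)) +
      3 * cnt3 (fun w p q => κ w = 0 ∧ Cross (g w) (κ p) (κ q)) ≤
      6 * (cs g (0, 1) * cs g (1, 0) * cs g (1, 1)) := by
  obtain ⟨h1, h2, h3⟩ := cnt2_cross_eq κ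
  have key : ∀ c, c ≠ 0 → cs g c = cs κ c + cnt1 (fun w => κ w = 0 ∧ g w = c) := by
    intro c hc
    rw [cs, cnt1_add_not _ (fun w => κ w = 0), add_comm, cs]
    congr 2
    · ext v
      constructor
      · rintro ⟨h, hv⟩; rw [← hg v hv, h]
      · rintro rfl; exact ⟨hg v hc, hc⟩
    · ext v; exact and_comm
  have k1 := key (0, 1) (by decide)
  have k2 := key (1, 0) (by decide)
  have k3 := key (1, 1) (by decide)
  have h4 : cnt3 (fun w p q => κ w = 0 ∧ Cross (g w) (κ p) (κ q)) ≤
      cnt1 (fun w => κ w = 0 ∧ g w = (0, 1)) * cnt2 (fun p q => Cross (0, 1) (κ p) (κ q)) +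
      (cnt1 (fun w => κ w = 0 ∧ g w = (1, 0)) * cnt2 (fun p q => Cross (1, 0) (κ p) (κ q)) +
      cnt1 (fun w => κ w = 0 ∧ g w = (1, 1)) * cnt2 (fun p q => Cross (1, 1) (κ p) (κ q))) := by
    simp only [← cnt3_prod]
    refine le_trans (cnt3_mono fun w p q hw => ?_) ((cnt3_or_le _ _).trans
      (Nat.add_le_add_left (cnt3_or_le _ _) _))
    have : ∀ c i j, Cross c i j → c = (0, 1) ∨ c = (1, 0) ∨ c = (1, 1) := by decide
    rcases this _ _ _ hw.2 with h | h | h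
    · exact Or.inl ⟨⟨hw.1, h⟩, h ▸ hw.2⟩
    · exact Or.inr (Or.inl ⟨⟨hw.1, h⟩, h ▸ hw.2⟩)
    · exact Or.inr (Or.inr ⟨⟨hw.1, h⟩, h ▸ hw.2⟩)
  rw [h1, h2, h3] at h4
  rw [k1, k2, k3]
  generalize cs κ (0, 1) = a at *
  generalize cs κ (1, 0) = b at *
  generalize cs κ (1, 1) = c at *
  generalize cnt1 (fun w => κ w = 0 ∧ g w = (0, 1)) = x at *
  generalize cnt1 (fun w => κ w = 0 ∧ g w = (1, 0)) = y at *
  generalize cnt1 (fun w => κ w = 0 ∧ g w = (1, 1)) = z at *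
  have : 6 * ((a + x) * (b + y) * (c + z)) = 6 * (a * b * c) +
    6 * (x * (b * c) + (y * (a * c) + z * (a * b))) +
    6 * (a * y * z + x * b * z + x * y * c + x * y * z) := by ring
  rw [this]
  linarith [Nat.zero_le (6 * (a * y * z + x * b * z + x * y * c + x * y * z))]

lemma weighted_parts_le {a b c μ : ℤ} (ha : 0 ≤ a) (hb : 0 ≤ b) (hc : 0 ≤ c)
    (hμ : 9 * μ ≤ a + b + c) :
    54 * (a * b * c) + 27 * μ * (a ^ 2 + b ^ 2 + c ^ 2) ≤
      2 * (a + b + c) ^ 3 + 9 * μ * (a + b + c) ^ 2 := by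
  nlinarith [mul_nonneg ha (sq_nonneg (b - c)), mul_nonneg hb (sq_nonneg (a - c)),
    mul_nonneg hc (sq_nonneg (a - b)), mul_nonneg (sub_nonneg.2 hμ) (sq_nonneg (b - c)),
    mul_nonneg (sub_nonneg.2 hμ) (sq_nonneg (a - c)),
    mul_nonneg (sub_nonneg.2 hμ) (sq_nonneg (a - b))]

lemma classification_arith {n C t x b μ E a₁ a₂ a₃ : ℤ} (hn : 0 < n) (ha₁ : 0 ≤ a₁)
    (ha₂ : 0 ≤ a₂) (ha₃ : 0 ≤ a₃) (hx : 0 ≤ x) (hb : 0 ≤ b) (hxb : x + b ≤ C) (hμ0 : 0 ≤ μ)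
    (hμ : 9 * μ + C ≤ n) (hC : 10 ^ 11 * C ^ 2 * n ≤ n ^ 2)
    (hsum : a₁ + a₂ + a₃ = n - (x + b))
    (hE : 5000 * E ≤ 30000 * (a₁ * a₂ * a₃) + 15000 * (μ * (a₁ ^ 2 + a₂ ^ 2 + a₃ ^ 2)) +
      3000 * n ^ 2 * b + 33 * n ^ 2)
    (hlow : 2 * n ^ 3 + 3 * t * n ^ 2 ≤ 9 * E + C ^ 2 * n) :
    15000 * t + 30000 * x + 3000 * b ≤ 45000 * μ + 298 := by
  have h1 := weighted_parts_le (μ := μ) ha₁ ha₂ ha₃ (by linarith)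
  rw [hsum] at h1
  set y := x + b with hy
  have hy0 : 0 ≤ y := by positivity
  have h2 : y ^ 2 * n ≤ C ^ 2 * n :=
    mul_le_mul_of_nonneg_right (pow_le_pow_left₀ hy0 hxb 2) hn.le
  have h3 : μ * (n - y) ^ 2 ≤ μ * n ^ 2 := by
    refine mul_le_mul_of_nonneg_left (pow_le_pow_left₀ ?_ ?_ 2) hμ0 <;> linarith
  have h4 : (n - y) ^ 3 ≤ n ^ 3 - 3 * y * n ^ 2 + 3 * (y ^ 2 * n) := by
    have : 0 ≤ y ^ 3 := by positivity
    nlinarith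
  have h5 : (15000 * t + 30000 * x + 3000 * b) * n ^ 2 ≤ (45000 * μ + 298) * n ^ 2 := by
    have h6 : 0 ≤ n ^ 2 := by positivity
    have h7 : y * n ^ 2 = x * n ^ 2 + b * n ^ 2 := by rw [hy]; ring
    linarith
  exact le_of_mul_le_mul_right h5 (by positivity)

end Classification

section Extension

variable {V : Type*} [Fintype V] {H : TSys V} {κ : V → Colour} {t C : ℕ}

lemma cnt2_le_inside (H : TSys V) (κ : V → Colour) (w : V) :
    cnt2 (H.E w) ≤ insideCnt H κ w + 2 * cs κ 0 * Fintype.card V := by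
  classical
  have h1 := cnt2_touch_le (univ.filter fun v => κ v = 0)
  have h2 := cnt2_or_le (fun p q => (κ p ≠ 0 ∧ κ q ≠ 0) ∧ H.E w p q)
    (fun a b => a ∈ univ.filter (fun v => κ v = 0) ∨ b ∈ univ.filter (fun v => κ v = 0))
  have h3 : #(univ.filter fun v => κ v = 0) = cs κ 0 := by
    rw [cs, ← cnt1_mem]
    congr 1
    ext v
    simp
  rw [h3] at h1
  unfold insideCnt
  refine le_trans (cnt2_mono fun p q h => ?_) (h2.trans (Nat.add_le_add_left h1 _))
  by_cases hp : κ p = 0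
  · exact Or.inr (Or.inl (by simpa using hp))
  by_cases hq : κ q = 0
  · exact Or.inr (Or.inr (by simpa using hq))
  exact Or.inl ⟨⟨hp, hq⟩, h⟩

lemma cnt2_true_and {P : V → V → Prop} {p : Prop} (hp : p) :
    cnt2 (fun a b => p ∧ P a b) = cnt2 P := by simp [hp]

namespace Near

/-- The exceptional vertices are distributed to the parts, except for `t` of them whose links
contain many pairs inside parts. -/
theorem exists_extension (h : Near H κ t C)
    (hlow : 2 * Fintype.card V ^ 3 + 3 * t * Fintype.card V ^ 2 ≤
      9 * cnt3 H.E + C ^ 2 * Fintype.card V) :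
    ∃ g : V → Colour, cs g 0 = t ∧ (∀ v, κ v ≠ 0 → g v = κ v) ∧
      (∀ v, g v ≠ 0 → 9 * Fintype.card V ^ 2 ≤ 50 * crossCnt H κ (g v) v) ∧
      ∀ v, g v = 0 → Fintype.card V ^ 2 ≤ 50 * sameCnt H κ v := by
  classical
  set n := Fintype.card V with hn
  set X : V → Prop := fun w => κ w = 0 ∧ n ^ 2 ≤ 50 * sameCnt H κ w with hX
  set Z : Colour → V → Prop := fun c w => c ≠ 0 ∧ 9 * n ^ 2 ≤ 50 * crossCnt H κ c w ∧
      1000 * C * insideCnt H κ w ≤ 1000 * C * crossCnt H κ c w + 2 * (2000 * C + n) * n with hZ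
  set g : V → Colour := fun w => if κ w ≠ 0 then κ w else
    if X w then 0 else if hc : ∃ c, Z c w then hc.choose else 0 with hg
  set B : V → Prop := fun w => κ w = 0 ∧ ¬ X w ∧ ¬ ∃ c, Z c w with hB
  have hgκ : ∀ v, κ v ≠ 0 → g v = κ v := fun v hv => if_pos hv
  have hgX : ∀ v, X v → g v = 0 := fun v hv => by
    simp only [hg, if_neg (not_not.2 hv.1), if_pos hv]
  have hgB : ∀ v, B v → g v = 0 := fun v hv => by
    simp only [hg, if_neg (not_not.2 hv.1), if_neg hv.2.1, dif_neg hv.2.2]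
  have hgZ : ∀ v, κ v = 0 → ¬ X v → (∃ c, Z c v) → Z (g v) v := fun v hv hx hc => by
    have : g v = hc.choose := by simp only [hg, if_neg (not_not.2 hv), if_neg hx, dif_pos hc]
    rw [this]
    exact hc.choose_spec
  have hg0 : ∀ v, g v = 0 → X v ∨ B v := by
    intro v hv
    by_cases hκ : κ v = 0
    · by_cases hx : X v
      · exact Or.inl hx
      by_cases hc : ∃ c, Z c v
      · exact absurd hv (hgZ v hκ hx hc).1
      · exact Or.inr ⟨hκ, hx, hc⟩
    · rw [hgκ v hκ] at hv
      exact absurd hv hκ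
  have hcs0 : cs g 0 = cnt1 X + cnt1 B := by
    rw [cs, cnt1_add_not _ X]
    congr 2
    · ext v
      exact ⟨fun h => h.2, fun h => ⟨hgX v h, h⟩⟩
    · ext v
      exact ⟨fun h => (hg0 v h.1).resolve_left h.2, fun h => ⟨hgB v h, h.2.1⟩⟩
  have hcs0C : cs g 0 ≤ C := by
    refine le_trans (cnt1_mono fun v hv => ?_) h.zero
    by_contra hκ
    rw [hgκ v hκ] at hv
    exact hκ hv
  set Er := 10 * (2000 * C + n) * n + 5000 * C * ((2000 * C ^ 2 + 8) * n) +
    5000 * C * (2 * C * n) with hEr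
  -- the contribution of a single exceptional vertex
  have hpoint : ∀ w, 5000 * C * cnt2 (fun p q => κ w = 0 ∧ H.E w p q) ≤
      5000 * C * cnt2 (fun p q => X w ∧ Same κ p q ∧ H.E w p q) +
      5000 * C * cnt2 (fun p q => κ w = 0 ∧ Cross (g w) (κ p) (κ q)) +
      1000 * C * n ^ 2 * (if B w then 1 else 0) + Er * (if κ w = 0 then 1 else 0) := by
    intro w
    by_cases hκ : κ w = 0
    swap
    · simp [hκ, cnt2]
    rw [cnt2_true_and hκ, cnt2_true_and hκ, if_pos hκ, mul_one]
    have h1 : cnt2 (H.E w) ≤ insideCnt H κ w + 2 * cs κ 0 * n := cnt2_le_inside H κ w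
    have h2 : 2 * cs κ 0 * n ≤ 2 * C * n :=
      Nat.mul_le_mul_right _ (Nat.mul_le_mul_left _ h.zero)
    have h3 : 5000 * C * cnt2 (H.E w) ≤ 5000 * C * insideCnt H κ w + 5000 * C * (2 * C * n) := by
      rw [← mul_add]
      exact Nat.mul_le_mul_left _ (by omega)
    have p1 := Nat.zero_le (5000 * C * ((2000 * C ^ 2 + 8) * n))
    have p2 := Nat.zero_le (5000 * C * cnt2 (fun p q => X w ∧ Same κ p q ∧ H.E w p q))
    have p3 := Nat.zero_le (1000 * C * n ^ 2 * (if B w then 1 else 0))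
    have p4 := Nat.zero_le (10 * (2000 * C + n) * n)
    have p5 := Nat.zero_le (5000 * C * cnt2 (fun p q => Cross (g w) (κ p) (κ q)))
    by_cases hx : X w
    · rw [cnt2_true_and hx]
      have h4 : insideCnt H κ w ≤ sameCnt H κ w + (2000 * C ^ 2 + 8) * n :=
        h.inside_le_of_same hx.2
      have h5 := Nat.mul_le_mul_left (5000 * C) h4
      unfold sameCnt at h5
      rw [hEr]
      linarith
    by_cases hc : ∃ c, Z c w
    · obtain ⟨h4, h5, h6⟩ := hgZ w hκ hx hc
      have h7 : crossCnt H κ (g w) w ≤ cnt2 (fun p q => Cross (g w) (κ p) (κ q)) :=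
        cnt2_mono fun p q h => h.1
      have h8 := Nat.mul_le_mul_left (5000 * C) h7
      rw [hEr]
      linarith
    · rw [if_pos ⟨hκ, hx, hc⟩]
      have h4 : 5 * insideCnt H κ w ≤ n ^ 2 := by
        rcases h.trichotomy w with h5 | ⟨c, h5⟩ | h5
        · exact absurd ⟨hκ, h5⟩ hx
        · exact absurd ⟨c, h5⟩ hc
        · exact h5
      have h5 := Nat.mul_le_mul_left (1000 * C) h4
      rw [hEr]
      linarith
  set W := cnt3 (fun a b c => κ a = 0 ∧ H.E a b c) with hW
  set SX := cnt3 (fun w p q => X w ∧ Same κ p q ∧ H.E w p q) with hSX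
  set ZC := cnt3 (fun w p q => κ w = 0 ∧ Cross (g w) (κ p) (κ q)) with hZC
  have hC0 : 0 < C := by have := h.C_pos; omega
  have hind : ∀ (P : V → Prop) [DecidablePred P], ∑ w, (if P w then 1 else 0) = cnt1 P := by
    intro P _
    rw [cnt1, card_filter]
    exact sum_congr rfl fun w _ => by split_ifs <;> rfl
  have hErn : Er ≤ 11 * n ^ 2 := by
    have h1 := h.mul_le
    have h2 := h.C_sq_mul_le
    have h3 := h.C_mul_le
    rw [← hn] at h1 h2 h3
    have : Er = 10 * n ^ 2 + 60000 * (C * n) + 10 ^ 7 * (C ^ 3 * n) + 10 ^ 4 * (C ^ 2 * n) := by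
      rw [hEr]; ring
    linarith
  have hWle : 5000 * W ≤ 5000 * SX + 5000 * ZC + 1000 * n ^ 2 * cnt1 B + 11 * n ^ 2 := by
    refine le_trans (Nat.le_of_mul_le_mul_left ?_ hC0) (Nat.add_le_add_left hErn _)
    have h1 := sum_le_sum fun w (_ : w ∈ univ) => hpoint w
    simp only [sum_add_distrib, ← mul_sum, hind] at h1
    rw [← cnt3_eq_sum, ← cnt3_eq_sum (fun w p q => X w ∧ Same κ p q ∧ H.E w p q),
      ← cnt3_eq_sum (fun w p q => κ w = 0 ∧ Cross (g w) (κ p) (κ q)),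
      ← hW, ← hSX, ← hZC, @hind B] at h1
    have h2 : Er * cnt1 (fun w => κ w = 0) ≤ Er * C := Nat.mul_le_mul_left _ h.zero
    linarith
  have hEle : cnt3 H.E ≤ 6 * (cs κ (0, 1) * cs κ (1, 0) * cs κ (1, 1)) + 3 * W := by
    refine (cnt3_le_avoid H fun v => κ v = 0).trans (Nat.add_le_add_right ?_ _)
    rw [← cnt3_cross]
    exact cnt3_mono fun a b c he => h.cross_of_edge he.1 he.2.1 he.2.2.1 he.2.2.2
  have hext := cnt3_cross_extend κ g hgκ
  rw [← hZC] at hext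
  have hmono : ∀ c, c ≠ 0 → cs κ c ≤ cs g c := fun c hc => cnt1_mono fun v hv => by
    rw [hgκ v (hv ▸ hc), hv]
  set σ := cs g (0, 1) ^ 2 + cs g (1, 0) ^ 2 + cs g (1, 1) ^ 2 with hσ
  have hsame : cnt2 (Same κ) ≤ σ := by
    rw [cnt2_same]
    exact Nat.add_le_add (Nat.add_le_add (Nat.pow_le_pow_left (hmono _ (by decide)) 2)
      (Nat.pow_le_pow_left (hmono _ (by decide)) 2)) (Nat.pow_le_pow_left (hmono _ (by decide)) 2)
  have hSXx : SX ≤ cnt1 X * σ := (cnt3_and_le_left fun w _ => cnt2_mono fun p q hpq => hpq.1).trans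
    (Nat.mul_le_mul_left _ hsame)
  have hSXt : SX ≤ t * σ := by
    rw [hSX, ← cnt3_rot, ← cnt3_rot]
    refine le_trans (cnt3_mono (Q := fun p q w => Same κ p q ∧ (n ^ 2 ≤ 50 * sameCnt H κ w ∧
      H.E w p q)) fun p q w hw => ⟨hw.2.1, hw.1.2, hw.2.2⟩) ?_
    refine (cnt3_and_le fun p q _ => h.cnt1_same_le p q).trans ?_
    rw [mul_comm]
    exact Nat.mul_le_mul_left _ hsame
  have hsum := card_eq_sum_cs g
  rw [← hn, hcs0] at hsum
  have hn0 : 0 < n := h.card_pos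
  have hcsq := h.C_sq_mul_le
  rw [← hn] at hcsq
  have hlow' : 2 * (n : ℤ) ^ 3 + 3 * t * n ^ 2 ≤ 9 * cnt3 H.E + C ^ 2 * n := by exact_mod_cast hlow
  have hbig : 10 * C ≤ n := by
    have := h.C_mul_le
    rw [← hn, sq] at this
    have := Nat.le_of_mul_le_mul_right this hn0
    omega
  have htC : t ≤ C := by have := h.le_C; omega
  have harith : ∀ μ : ℕ, μ ≤ C → SX ≤ μ * σ →
      15000 * (t : ℤ) + 30000 * cnt1 X + 3000 * cnt1 B ≤ 45000 * μ + 298 := by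
    intro μ hμ hSXμ
    refine classification_arith (n := n) (C := C) (E := cnt3 H.E) (a₁ := cs g (0, 1))
      (a₂ := cs g (1, 0)) (a₃ := cs g (1, 1)) (by exact_mod_cast hn0) (by positivity)
      (by positivity) (by positivity) (by positivity) (by positivity)
      (by exact_mod_cast hcs0 ▸ hcs0C) (by positivity) (by omega) (by exact_mod_cast hcsq)
      (by omega) ?_ hlow'
    have : 5000 * cnt3 H.E ≤ 30000 * (cs g (0, 1) * cs g (1, 0) * cs g (1, 1)) +
        15000 * (μ * σ) + 3000 * n ^ 2 * cnt1 B + 33 * n ^ 2 := by linarith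
    exact_mod_cast this
  have hxt : cnt1 X ≤ t := by
    by_contra! hcon
    have := harith t htC hSXt
    omega
  have := harith (cnt1 X) (by omega) hSXx
  have hxt' : cnt1 X = t := by omega
  have hb : cnt1 B = 0 := by omega
  have hB0 : ∀ v, ¬ B v := by
    intro v hv
    have h1 : cnt1 (fun u => u ∈ ({v} : Finset V)) ≤ cnt1 B :=
      cnt1_mono fun u hu => by rwa [mem_singleton.1 hu]
    rw [cnt1_mem, card_singleton] at h1
    omega
  refine ⟨g, by omega, hgκ, fun v hv => ?_, fun v hv => ((hg0 v hv).resolve_right (hB0 v)).2⟩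
  by_cases hκ : κ v = 0
  · have hX : ¬ X v := fun hx => hv (hgX v hx)
    have hc : ∃ c, Z c v := by
      by_contra hc
      exact hB0 v ⟨hκ, hX, hc⟩
    exact (hgZ v hκ hX hc).2.1
  · rw [hgκ v hκ]
    exact h.deg' hκ

end Near

end Extension

section Pattern

variable {V : Type*}

/-- The 3-graph of all triples whose colours sum to zero. The colour class of `0` is the clique
`X` of the extremal construction and the other three classes are the parts. -/
def pattern (g : V → Colour) : TSys V where
  E a b c := a ≠ b ∧ b ≠ c ∧ a ≠ c ∧ g a + g b + g c = 0
  swap h := ⟨h.1.symm, h.2.2.1, h.2.1, by rw [add_comm (g _)]; exact h.2.2.2⟩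
  rot h := ⟨h.2.1, h.2.2.1.symm, h.1.symm, by rw [← h.2.2.2]; ring⟩
  ne h := h.1

lemma Colour.add_self (c : Colour) : c + c = 0 := by revert c; decide

lemma Colour.add_eq_zero {i j : Colour} : i + j = 0 ↔ i = j := by revert i j; decide

variable [Fintype V] {H : TSys V} {κ : V → Colour} {t C : ℕ}

lemma cs_le_codeg_pattern (g : V → Colour) {p q : V} (hpq : p ≠ q) :
    cs g (g p + g q) ≤ codeg (pattern g) p q + 2 := by
  classical
  have h1 := cnt1_or_le ((pattern g).E p q) (fun u => u ∈ ({p, q} : Finset V))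
  have h2 : #({p, q} : Finset V) ≤ 2 := card_le_two
  rw [cnt1_mem] at h1
  refine le_trans (cnt1_mono fun u hu => ?_) (h1.trans (Nat.add_le_add_left h2 _))
  by_cases hu' : u ∈ ({p, q} : Finset V)
  · exact Or.inr hu'
  · simp only [mem_insert, mem_singleton, not_or] at hu'
    exact Or.inl ⟨hpq, Ne.symm hu'.2, Ne.symm hu'.1, by rw [hu, Colour.add_self]⟩

lemma not_of_cnt3_eq_zero {P : V → V → V → Prop} (h : cnt3 P = 0) (a b c : V) : ¬ P a b c := by
  intro hP
  classical
  exact filter_eq_empty_iff.1 (card_eq_zero.1 h) (mem_univ (a, b, c)) hP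

lemma iff_of_cnt3_le {P Q : V → V → V → Prop} (hle : cnt3 P ≤ cnt3 Q)
    (hQ : ∀ a b c, Q a b c → P a b c) (a b c : V) : Q a b c ↔ P a b c := by
  refine ⟨hQ a b c, fun hP => ?_⟩
  by_contra hcon
  have h1 := cnt3_add_not P Q
  have h2 : cnt3 Q ≤ cnt3 (fun a b c => P a b c ∧ Q a b c) :=
    cnt3_mono fun a b c h => ⟨hQ a b c h, h⟩
  exact not_of_cnt3_eq_zero (P := fun a b c => P a b c ∧ ¬ Q a b c) (by omega) a b c ⟨hP, hcon⟩

namespace Near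

/-- A 3-graph near the complete tripartite one with at least as many edges as the pattern
provided by `Near.exists_extension` equals that pattern. -/
theorem eq_pattern (h : Near H κ t C) {g : V → Colour} (hgκ : ∀ v, κ v ≠ 0 → g v = κ v)
    (hcross : ∀ v, g v ≠ 0 → 9 * Fintype.card V ^ 2 ≤ 50 * crossCnt H κ (g v) v)
    (hsame : ∀ v, g v = 0 → Fintype.card V ^ 2 ≤ 50 * sameCnt H κ v)
    (hle : cnt3 (pattern g).E ≤ cnt3 H.E) (a b c : V) : H.E a b c ↔ (pattern g).E a b c := by
  set n := Fintype.card V with hn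
  have hroot : ∀ v, g v ≠ 0 → ¬ Root H v := fun v hv => h.not_root_of_cross (hcross v hv)
  have hne : ∀ a b c, H.E a b c → g a ≠ 0 → g c ≠ 0 → g a ≠ g b := by
    intro a b c hE ha hc hab
    obtain ⟨p, q, h1, h2, hp, hq⟩ := h.exists_common_link (U := {c})
      (by have := h.C_pos; simp; omega) (hcross a ha) (hab ▸ hcross b (hab ▸ ha))
    exact hroot c hc ⟨p, q, a, b, by simpa using hp, by simpa using hq, H.ne hE, h1, h2, hE⟩
  have hzero : ∀ a b c, H.E a b c → g a + g b + g c ≠ 0 → g a = 0 ∨ g b = 0 ∨ g c = 0 := by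
    intro a b c hE hs
    by_contra! hcon
    have h1 := hne a b c hE hcon.1 hcon.2.2
    have h2 := hne b c a (H.rot hE) hcon.2.1 hcon.1
    have h3 := hne a c b (H.swap_right hE) hcon.1 hcon.2.1
    obtain ⟨-, -, -, h4⟩ := cross_of_ne hcon.1 hcon.2.1 hcon.2.2 h1 h2 h3
    refine hs ?_
    rw [add_assoc, add_comm, h4, Colour.add_self]
  set Q : V → V → Prop := fun p q => codeg H p q ≤ t ∧ n ≤ 5 * codeg (pattern g) p q with hQ
  have hbig : 1000 * (t + 1) ≤ n := by
    have h1 := h.C_mul_le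
    have h2 := h.le_C
    rw [← hn, sq] at h1
    have := Nat.le_of_mul_le_mul_right h1 h.card_pos
    omega
  have hQof : ∀ x p q, H.E x p q → g x = 0 → g p ≠ g q → Q p q := by
    intro x p q hE hx hpq
    refine ⟨h.codeg_le_of_edge (hsame x hx) hE, ?_⟩
    have h1 := cs_le_codeg_pattern g (H.ne_right hE)
    have h2 : g p + g q ≠ 0 := fun h0 => hpq (Colour.add_eq_zero.1 h0)
    have h3 := h.le_size _ h2
    have h4 : cs κ (g p + g q) ≤ cs g (g p + g q) := cnt1_mono fun v hv => by
      rw [hgκ v (hv ▸ h2), hv]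
    omega
  set Wrong : V → V → V → Prop := fun a b c => H.E a b c ∧ ¬ (pattern g).E a b c with hWrong
  set Miss : V → V → V → Prop := fun a b c => (pattern g).E a b c ∧ ¬ H.E a b c with hMiss
  set R : V → V → V → Prop := fun a b c => Q a b ∧ H.E a b c with hR
  have hW : cnt3 Wrong ≤ 3 * cnt3 R := by
    have h1 : cnt3 Wrong ≤ cnt3 (fun a b c => R b c a ∨ (R a c b ∨ R a b c)) := by
      refine cnt3_mono fun a b c hw => ?_
      have hs : g a + g b + g c ≠ 0 := fun h0 =>
        hw.2 ⟨H.ne hw.1, H.ne_right hw.1, H.ne_outer hw.1, h0⟩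
      have : ∀ i j k : Colour, i + j + k ≠ 0 → i = 0 ∨ j = 0 ∨ k = 0 →
        (i = 0 ∧ j ≠ k) ∨ (j = 0 ∧ i ≠ k) ∨ (k = 0 ∧ i ≠ j) := by decide
      rcases this _ _ _ hs (hzero a b c hw.1 hs) with h2 | h2 | h2
      · exact Or.inl ⟨hQof a b c hw.1 h2.1 h2.2, H.rot hw.1⟩
      · exact Or.inr (Or.inl ⟨hQof b a c (H.swap hw.1) h2.1 h2.2, H.swap_right hw.1⟩)
      · exact Or.inr (Or.inr ⟨hQof c a b (H.rot (H.rot hw.1)) h2.1 h2.2, hw.1⟩)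
    have h2 := cnt3_or_le (fun a b c => R b c a) (fun a b c => R a c b ∨ R a b c)
    have h3 := cnt3_or_le (fun a b c => R a c b) R
    rw [cnt3_rot R] at h2
    rw [cnt3_swap_right R] at h3
    omega
  have hRt : cnt3 R ≤ cnt2 Q * t := cnt3_and_le fun p q hq => hq.1
  have hM : cnt2 Q * (3 * t + 1) ≤ cnt3 Miss := by
    refine le_trans (le_cnt3_and (R := Miss) fun p q hq => ?_) (cnt3_mono fun a b c hm => hm.2)
    have h1 := cnt1_add_not ((pattern g).E p q) (H.E p q)
    have h2 : cnt1 (fun u => (pattern g).E p q u ∧ H.E p q u) ≤ t :=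
      (cnt1_mono fun u hu => hu.2).trans hq.1
    have h3 := hq.2
    unfold codeg at h3
    simp only [hMiss]
    omega
  have e1 := cnt3_add_not H.E (pattern g).E
  have e2 := cnt3_add_not (pattern g).E H.E
  have e3 : cnt3 (fun a b c => (pattern g).E a b c ∧ H.E a b c) =
      cnt3 (fun a b c => H.E a b c ∧ (pattern g).E a b c) := by simp only [and_comm]
  have hQ0 : cnt2 Q = 0 := by
    rw [← hWrong] at e1
    rw [← hMiss] at e2
    nlinarith
  have hW0 : cnt3 Wrong = 0 := by
    rw [hQ0] at hRt
    omega
  refine iff_of_cnt3_le hle (fun a b c hE => ?_) a b c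
  by_contra hP
  exact not_of_cnt3_eq_zero hW0 a b c ⟨hE, hP⟩

end Near

end Pattern

section Extremal

variable {V : Type*} [Fintype V]

lemma cnt3_diag (R : V → V → Prop) : cnt3 (fun a b c => a = b ∧ R b c) = cnt2 R := by
  classical
  refine card_bij' (fun x _ => x.2) (fun x _ => (x.1, x)) ?_ ?_ ?_ ?_ <;> aesop

lemma cnt2_diag (R : V → Prop) : cnt2 (fun a b => a = b ∧ R b) = cnt1 R := by
  classical
  refine card_bij' (fun x _ => x.2) (fun x _ => (x, x)) ?_ ?_ ?_ ?_ <;> aesop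

lemma cnt1_true : cnt1 (fun _ : V => True) = Fintype.card V := by simp [cnt1]

/-- The number of ordered edges of a pattern. -/
lemma cnt3_pattern (g : V → Colour) :
    cnt3 (pattern g).E + 3 * (Fintype.card V * cs g 0) =
      cs g 0 ^ 3 + 3 * cs g 0 * (cs g (0, 1) ^ 2 + cs g (1, 0) ^ 2 + cs g (1, 1) ^ 2) +
      6 * (cs g (0, 1) * cs g (1, 0) * cs g (1, 1)) + 2 * cs g 0 := by
  set S : V → V → V → Prop := fun a b c => g a + g b + g c = 0 with hS
  have h0 : cnt3 S = cs g 0 ^ 3 +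
      3 * cs g 0 * (cs g (0, 1) ^ 2 + cs g (1, 0) ^ 2 + cs g (1, 1) ^ 2) +
      6 * (cs g (0, 1) * cs g (1, 0) * cs g (1, 1)) := by
    rw [hS, cnt3_colour g fun i j k => i + j + k = 0]
    simp only [sum_colour]
    simp +decide
    ring
  have h1 := cnt3_add_not S fun a b _ => a = b
  have h2 := cnt3_add_not (fun a b c => S a b c ∧ ¬ a = b) fun _ b c => b = c
  have h3 := cnt3_add_not (fun a b c => (S a b c ∧ ¬ a = b) ∧ ¬ b = c) fun a _ c => a = c
  have e1 : cnt3 (fun a b c => S a b c ∧ a = b) = Fintype.card V * cs g 0 := by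
    rw [← cnt1_true, cs, ← cnt2_prod, ← cnt3_diag]
    congr 1
    ext a b c
    simp only [hS, true_and]
    constructor
    · rintro ⟨h, rfl⟩
      exact ⟨rfl, by rwa [Colour.add_self, zero_add] at h⟩
    · rintro ⟨rfl, h⟩
      exact ⟨by rw [Colour.add_self, zero_add, h], rfl⟩
  have e0 : cnt2 (fun p q => p ≠ q ∧ g q = 0) + cs g 0 = Fintype.card V * cs g 0 := by
    have := cnt2_add_not (fun (_ q : V) => True ∧ g q = 0) fun p q => p = q
    rw [cnt2_prod, cnt1_true] at this
    rw [cs, this, add_comm]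
    congr 1
    · rw [← cnt2_diag]
      congr 1
      ext p q
      tauto
    · congr 1
      ext p q
      tauto
  have e2 : cnt3 (fun a b c => (S a b c ∧ ¬ a = b) ∧ b = c) =
      cnt2 (fun p q => p ≠ q ∧ g q = 0) := by
    rw [← cnt3_diag, ← cnt3_rot fun a b c => a = b ∧ b ≠ c ∧ g c = 0]
    congr 1
    ext a b c
    simp only [hS]
    constructor
    · rintro ⟨⟨h, hab⟩, rfl⟩
      exact ⟨rfl, Ne.symm hab, by rwa [add_assoc, Colour.add_self, add_zero] at h⟩
    · rintro ⟨rfl, hab, h⟩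
      exact ⟨⟨by rw [add_assoc, Colour.add_self, add_zero, h], Ne.symm hab⟩, rfl⟩
  have e3 : cnt3 (fun a b c => ((S a b c ∧ ¬ a = b) ∧ ¬ b = c) ∧ a = c) =
      cnt2 (fun p q => p ≠ q ∧ g q = 0) := by
    rw [← cnt3_diag, ← cnt3_swap_right fun a b c => a = b ∧ b ≠ c ∧ g c = 0]
    congr 1
    ext a b c
    simp only [hS]
    constructor
    · rintro ⟨⟨⟨h, hab⟩, hbc⟩, rfl⟩
      exact ⟨rfl, hab, by rwa [add_right_comm, Colour.add_self, zero_add] at h⟩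
    · rintro ⟨rfl, hab, h⟩
      exact ⟨⟨⟨by rw [add_right_comm, Colour.add_self, zero_add, h], hab⟩, Ne.symm hab⟩, rfl⟩
  have e4 : cnt3 (fun a b c => ((S a b c ∧ ¬ a = b) ∧ ¬ b = c) ∧ ¬ a = c) =
      cnt3 (pattern g).E := by
    congr 1
    ext a b c
    simp only [hS, pattern]
    tauto
  rw [e1] at h1
  rw [e2] at h2
  rw [e3, e4] at h3
  omega

lemma pattern_fsimFree {g : V → Colour} {t : ℕ} (hg : cs g 0 ≤ t) : FsimFree (pattern g) t := by
  classical
  intro a b c d v p q T _ _ _ _ _ _ _ _ _ _ _ hT hTt h1 h2 h3 h4 h5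
  have hcd : g c = g d := by
    have := h1.2.2.2.trans h2.2.2.2.symm
    exact add_left_cancel this
  have hv : g v = 0 := by
    have := h3.2.2.2
    rwa [hcd, Colour.add_self, zero_add] at this
  have hpq : g p = g q := by
    have := h4.2.2.2
    rw [hv, zero_add] at this
    exact Colour.add_eq_zero.1 this
  have hsub : cnt1 (fun u => u ∈ insert v T) ≤ cs g 0 := cnt1_mono fun u hu => by
    rcases mem_insert.1 hu with rfl | hu
    · exact hv
    · have := (h5 u hu).2.2.2
      rwa [hpq, Colour.add_self, zero_add] at this
  rw [cnt1_mem, card_insert_of_notMem fun hvT => (hT v hvT).2.2.2.2 rfl] at hsub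
  omega

lemma exists_colouring {x a b c : ℕ} (h : x + a + b + c = Fintype.card V) :
    ∃ g : V → Colour, cs g 0 = x ∧ cs g (0, 1) = a ∧ cs g (1, 0) = b ∧ cs g (1, 1) = c := by
  classical
  have e : V ≃ (Fin x ⊕ Fin a) ⊕ (Fin b ⊕ Fin c) :=
    Fintype.equivOfCardEq (by simp [← h]; ring)
  set f : (Fin x ⊕ Fin a) ⊕ (Fin b ⊕ Fin c) → Colour :=
    Sum.elim (Sum.elim (fun _ => 0) fun _ => (0, 1)) (Sum.elim (fun _ => (1, 0)) fun _ => (1, 1))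
    with hf
  have key : ∀ k, cs (f ∘ e) k = ∑ y, if f y = k then 1 else 0 := fun k => by
    rw [cs, cnt1, card_filter, ← e.sum_comp]
    exact sum_congr rfl fun v _ => by congr
  refine ⟨f ∘ e, ?_, ?_, ?_, ?_⟩ <;>
    rw [key, Fintype.sum_sum_type, Fintype.sum_sum_type, Fintype.sum_sum_type] <;>
    simp +decide [hf]

lemma pattern_arith {t a b c N C F : ℤ} (ht : 0 ≤ t) (hN : 0 ≤ N) (hC : 100 * (t + 1) ≤ C)
    (habc : N ^ 3 ≤ 27 * (a * b * c) + 4 * N) (hsq : N ^ 2 ≤ 3 * (a ^ 2 + b ^ 2 + c ^ 2))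
    (hF : F + 3 * ((N + t) * t) = t ^ 3 + 3 * t * (a ^ 2 + b ^ 2 + c ^ 2) + 6 * (a * b * c) + 2 * t) :
    2 * (N + t) ^ 3 + 3 * t * (N + t) ^ 2 ≤ 9 * F + C ^ 2 * (N + t) := by
  have h1 : t * N ^ 2 ≤ t * (3 * (a ^ 2 + b ^ 2 + c ^ 2)) := mul_le_mul_of_nonneg_left hsq ht
  have h2 : (100 * (t + 1)) ^ 2 * (N + t) ≤ C ^ 2 * (N + t) :=
    mul_le_mul_of_nonneg_right (pow_le_pow_left₀ (by positivity) hC 2) (by positivity)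
  have h3 : 0 ≤ t ^ 2 * N := by positivity
  have h4 : 0 ≤ t * N := by positivity
  have h5 : 0 ≤ t ^ 3 := by positivity
  have h6 : 0 ≤ t ^ 2 := by positivity
  nlinarith

lemma exists_large_pattern {t C : ℕ} (htn : t ≤ Fintype.card V) (hC : 100 * (t + 1) ≤ C) :
    ∃ g : V → Colour, cs g 0 = t ∧ 2 * Fintype.card V ^ 3 + 3 * t * Fintype.card V ^ 2 ≤
      9 * cnt3 (pattern g).E + C ^ 2 * Fintype.card V := by
  obtain ⟨N, hN⟩ := Nat.exists_eq_add_of_le' htn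
  obtain ⟨g, h0, h1, h2, h3⟩ := exists_colouring (V := V) (x := t) (a := N / 3)
    (b := (N + 1) / 3) (c := (N + 2) / 3) (by omega)
  refine ⟨g, h0, ?_⟩
  have hF := cnt3_pattern g
  rw [h0, h1, h2, h3] at hF
  rw [hN] at hF ⊢
  zify at hF ⊢
  refine pattern_arith (by positivity) (by positivity) (by exact_mod_cast hC) ?_ ?_ hF <;>
  · obtain ⟨k, hk⟩ : ∃ k, N = 3 * k ∨ N = 3 * k + 1 ∨ N = 3 * k + 2 := ⟨N / 3, by omega⟩
    have hk0 : (0 : ℤ) ≤ k := by positivity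
    rcases hk with rfl | rfl | rfl
    · have e1 : ((3 * k : ℕ) : ℤ) / 3 = k := by omega
      have e2 : (((3 * k : ℕ) : ℤ) + 1) / 3 = k := by omega
      have e3 : (((3 * k : ℕ) : ℤ) + 2) / 3 = k := by omega
      rw [e1, e2, e3]
      push_cast
      nlinarith
    · have e1 : ((3 * k + 1 : ℕ) : ℤ) / 3 = k := by omega
      have e2 : (((3 * k + 1 : ℕ) : ℤ) + 1) / 3 = k := by omega
      have e3 : (((3 * k + 1 : ℕ) : ℤ) + 2) / 3 = k + 1 := by omega
      rw [e1, e2, e3]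
      push_cast
      nlinarith
    · have e1 : ((3 * k + 2 : ℕ) : ℤ) / 3 = k := by omega
      have e2 : (((3 * k + 2 : ℕ) : ℤ) + 1) / 3 = k + 1 := by omega
      have e3 : (((3 * k + 2 : ℕ) : ℤ) + 2) / 3 = k + 1 := by omega
      rw [e1, e2, e3]
      push_cast
      nlinarith

/-- In a largest pattern the parts are balanced. -/
lemma part_le_of_max {g : V → Colour} {t : ℕ} (hg0 : cs g 0 = t)
    (hbig : ∀ c, c ≠ 0 → t < cs g c)
    (hmax : ∀ g' : V → Colour, cs g' 0 = t → cnt3 (pattern g').E ≤ cnt3 (pattern g).E)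
    {c d : Colour} (hc : c ≠ 0) (hd : d ≠ 0) : cs g c ≤ cs g d + 1 := by
  have hsum := card_eq_sum_cs g
  have hF := cnt3_pattern g
  have h1 := hbig (0, 1) (by decide)
  have h2 := hbig (1, 0) (by decide)
  have h3 := hbig (1, 1) (by decide)
  rw [hg0] at hsum hF
  have key : ∀ x y z : ℕ, t + x + y + z = Fintype.card V →
      3 * t * (x ^ 2 + y ^ 2 + z ^ 2) + 6 * (x * y * z) ≤
      3 * t * (cs g (0, 1) ^ 2 + cs g (1, 0) ^ 2 + cs g (1, 1) ^ 2) +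
        6 * (cs g (0, 1) * cs g (1, 0) * cs g (1, 1)) := by
    intro x y z hxyz
    obtain ⟨g', h0, h1, h2, h3⟩ := exists_colouring hxyz
    have hF' := cnt3_pattern g'
    have := hmax g' h0
    rw [h0, h1, h2, h3] at hF'
    omega
  have gain : ∀ x y z : ℕ, t < z → y + 2 ≤ x →
      3 * t * (x ^ 2 + y ^ 2 + z ^ 2) + 6 * (x * y * z) <
      3 * t * ((x - 1) ^ 2 + (y + 1) ^ 2 + z ^ 2) + 6 * ((x - 1) * (y + 1) * z) := by
    intro x y z hz hxy
    obtain ⟨u, rfl⟩ := Nat.exists_eq_add_of_le hxy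
    obtain ⟨w, rfl⟩ := Nat.exists_eq_add_of_lt hz
    rw [show y + 2 + u - 1 = y + 1 + u by omega]
    nlinarith [Nat.zero_le (u * w)]
  by_contra! hcon
  have hcolour : ∀ c : Colour, c ≠ 0 → c = (0, 1) ∨ c = (1, 0) ∨ c = (1, 1) := by decide
  rcases hcolour c hc with rfl | rfl | rfl <;> rcases hcolour d hd with rfl | rfl | rfl <;>
    generalize cs g (0, 1) = x at * <;> generalize cs g (1, 0) = y at * <;>
    generalize cs g (1, 1) = z at *
  · omega
  · linarith [key (x - 1) (y + 1) z (by omega), gain x y z h3 hcon]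
  · linarith [key (x - 1) y (z + 1) (by omega), gain x z y h2 hcon]
  · linarith [key (x + 1) (y - 1) z (by omega), gain y x z h3 hcon]
  · omega
  · linarith [key x (y - 1) (z + 1) (by omega), gain y z x h1 hcon]
  · linarith [key (x + 1) y (z - 1) (by omega), gain z x y h2 hcon]
  · linarith [key x (y + 1) (z - 1) (by omega), gain z y x h1 hcon]
  · omega

/-- An `F_sim(t)`-free 3-graph with at least as many edges as every pattern with `t` vertices of
colour `0` is a balanced pattern. -/
theorem FsimFree.exists_eq_pattern {H : TSys V} {t C : ℕ} (hF : FsimFree H t) (ht : 1 ≤ t)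
    (hC : 126 * (3 * t + 48) ≤ C) (hn : 10 ^ 8 * C ^ 3 ≤ Fintype.card V)
    (hmax : ∀ g : V → Colour, cs g 0 = t → cnt3 (pattern g).E ≤ cnt3 H.E) :
    ∃ g : V → Colour, cs g 0 = t ∧ (∀ c d, c ≠ 0 → d ≠ 0 → cs g c ≤ cs g d + 1) ∧
      ∀ a b c, H.E a b c ↔ (pattern g).E a b c := by
  set n := Fintype.card V with hndef
  have hC2 : C ^ 2 ≤ n := by
    have h1 : 1 * C ^ 2 ≤ C ^ 3 :=
      (Nat.mul_le_mul_right _ (by omega)).trans_eq (pow_succ' C 2).symm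
    omega
  have hC1 : C ≤ C ^ 2 := Nat.le_self_pow two_ne_zero C
  obtain ⟨g₀, hg₀, hlow₀⟩ := exists_large_pattern (V := V) (t := t) (C := C) (by omega) (by omega)
  rw [← hndef] at hlow₀
  have hlow : 2 * n ^ 3 + 3 * t * n ^ 2 ≤ 9 * cnt3 H.E + C ^ 2 * n := by
    have := hmax g₀ hg₀
    omega
  have hE : 2 * n ^ 3 ≤ 9 * cnt3 H.E := by
    have h1 : C ^ 2 * n ≤ n ^ 2 := by rw [sq n]; exact Nat.mul_le_mul_right _ hC2
    have h2 : 1 * n ^ 2 ≤ 3 * t * n ^ 2 := Nat.mul_le_mul_right _ (by omega)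
    omega
  obtain ⟨κ, h1, h2, h3, h4⟩ := hF.exists_partition hC (by
    refine le_trans (Nat.mul_le_mul_left _ (Nat.le_self_pow three_ne_zero C)) hn) hE
  have near : Near H κ t C :=
    ⟨hF, ht, hC, hn, h1, h2, h3, fun c hc => (h4 c hc).1, fun c hc => (h4 c hc).2⟩
  obtain ⟨g, hg0, hgκ, hcross, hsame⟩ := near.exists_extension hlow
  have heq := near.eq_pattern hgκ hcross hsame (hmax g hg0)
  refine ⟨g, hg0, fun c d hc hd => part_le_of_max hg0 (fun k hk => ?_) (fun g' hg' => ?_) hc hd,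
    heq⟩
  · have h5 := (h4 k hk).1
    have h6 : cs κ k ≤ cs g k := cnt1_mono fun v hv => by rw [hgκ v (hv ▸ hk), hv]
    have h7 : 10 ^ 8 * C ≤ n :=
      le_trans (Nat.mul_le_mul_left _ (Nat.le_self_pow three_ne_zero C)) hn
    omega
  · have : cnt3 H.E = cnt3 (pattern g).E := by
      congr 1
      ext a b c
      exact heq a b c
    exact this ▸ hmax g' hg'

end Extremal

/-- The edge set of a pattern. -/
def patternEdges {V : Type*} [Fintype V] (g : V → Colour) : Finset (Finset V) :=
  univ.filter fun e => #e = 3 ∧ ∑ v ∈ e, g v = 0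

lemma card_of_mem_patternEdges {V : Type*} [Fintype V] {g : V → Colour} :
    ∀ e ∈ patternEdges g, #e = 3 :=
  fun _ he => (mem_filter.1 he).2.1

section Transfer

variable {V : Type*} [DecidableEq V]

/-- The triple system of an edge set. -/
def ofEdges (G : Finset (Finset V)) : TSys V where
  E a b c := a ≠ b ∧ b ≠ c ∧ a ≠ c ∧ {a, b, c} ∈ G
  swap h := ⟨h.1.symm, h.2.2.1, h.2.1, by rw [insert_comm]; exact h.2.2.2⟩
  rot {a b c} h := ⟨h.2.1, h.2.2.1.symm, h.1.symm, by
    have : ({b, c, a} : Finset V) = {a, b, c} := by ext x; simp; tauto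
    rw [this]
    exact h.2.2.2⟩
  ne h := h.1

lemma cnt3_ofEdges [Fintype V] {G : Finset (Finset V)} (hG : ∀ e ∈ G, #e = 3) :
    cnt3 (ofEdges G).E = 6 * #G := by
  classical
  have hmap : ∀ x ∈ univ.filter (fun x : V × V × V => (ofEdges G).E x.1 x.2.1 x.2.2),
      ({x.1, x.2.1, x.2.2} : Finset V) ∈ G := fun x hx => (mem_filter.1 hx).2.2.2.2
  unfold cnt3
  rw [card_eq_sum_card_fiberwise hmap, mul_comm, ← smul_eq_mul, ← sum_const]
  refine sum_congr rfl fun e he => ?_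
  obtain ⟨x, y, z, hxy, hxz, hyz, rfl⟩ := card_eq_three.1 (hG e he)
  have : (univ.filter (fun x : V × V × V => (ofEdges G).E x.1 x.2.1 x.2.2)).filter
      (fun w => ({w.1, w.2.1, w.2.2} : Finset V) = {x, y, z}) =
      {(x, y, z), (x, z, y), (y, x, z), (y, z, x), (z, x, y), (z, y, x)} := by
    ext ⟨a, b, c⟩
    simp only [mem_filter, mem_univ, true_and, mem_insert, mem_singleton, Prod.mk.injEq]
    constructor
    · rintro ⟨⟨hab, hbc, hac, -⟩, he⟩
      have ha : a ∈ ({x, y, z} : Finset V) := he ▸ by simp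
      have hb : b ∈ ({x, y, z} : Finset V) := he ▸ by simp
      have hc : c ∈ ({x, y, z} : Finset V) := he ▸ by simp
      simp only [mem_insert, mem_singleton] at ha hb hc
      grind
    · intro h
      have hset : ({a, b, c} : Finset V) = {x, y, z} := by
        ext u
        simp only [mem_insert, mem_singleton]
        grind
      refine ⟨⟨?_, ?_, ?_, hset ▸ he⟩, hset⟩ <;> grind
  rw [this]
  simp [card_insert_of_notMem, hxy, hxz, hyz, hxy.symm, hxz.symm, hyz.symm]

lemma hasCopy_of_edges {G : Finset (Finset V)} {t : ℕ} {a b c d v p q : V} {T : Finset V}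
    (hnd : [a, b, c, d, v, p, q].Nodup) (hT : ∀ u ∈ T, u ∉ [a, b, c, d, v, p, q]) (hTt : #T = t)
    (h1 : {a, b, c} ∈ G) (h2 : {a, b, d} ∈ G) (h3 : {c, d, v} ∈ G) (h4 : {v, p, q} ∈ G)
    (h5 : ∀ u ∈ T, {p, q, u} ∈ G) : HasCopy G (Fsim t) := by
  have e : Fin t ≃ T := (T.equivFinOfCardEq hTt).symm
  refine ⟨⟨Sum.elim [a, b, c, d, v, p, q].get fun j => (e j : V),
    Function.Injective.sumElim (List.nodup_iff_injective_get.1 hnd)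
      (Subtype.val_injective.comp e.injective) fun i j hij => ?_⟩, fun s hs => ?_⟩
  · exact hT _ (e j).2 (hij ▸ List.get_mem [a, b, c, d, v, p, q] i)
  · simp only [Fsim, mem_union, mem_insert, mem_singleton, mem_image, mem_univ, true_and] at hs
    rcases hs with (rfl | rfl | rfl | rfl) | ⟨j, rfl⟩ <;>
      simp only [image_insert, image_singleton, Function.Embedding.coeFn_mk, Sum.elim_inl,
        Sum.elim_inr]
    exacts [h1, h2, h3, h4, h5 _ (e j).2]

lemma fsimFree_ofEdges {G : Finset (Finset V)} {t : ℕ} (hG : ¬ HasCopy G (Fsim t)) :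
    FsimFree (ofEdges G) t := by
  rintro a b c d v p q T hav hbv hcd hpa hpb hpc hpd hqa hqb hqc hqd hT hTt
    ⟨hab, hbc, hac, h1⟩ ⟨-, hbd, had, h2⟩ ⟨-, hdv, hcv, h3⟩ ⟨hvp, hpq, hvq, h4⟩ h5
  refine hG (hasCopy_of_edges (T := T) ?_ (fun u hu => ?_) hTt h1 h2 h3 h4
    fun u hu => (h5 u hu).2.2.2)
  · simp only [List.nodup_cons, List.mem_cons, List.not_mem_nil, or_false, not_or,
      not_false_eq_true, List.nodup_nil, and_true]
    grind
  · obtain ⟨h6, h7, h8, h9, h10⟩ := hT u hu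
    have h11 := (h5 u hu).2.1.symm
    have h12 := (h5 u hu).2.2.1.symm
    simp [*]

lemma not_hasCopy_of_fsimFree {G : Finset (Finset V)} {t : ℕ} (hF : FsimFree (ofEdges G) t) :
    ¬ HasCopy G (Fsim t) := by
  rintro ⟨f, hf⟩
  have hinl : ∀ i j : Fin 7, i ≠ j → f (Sum.inl i) ≠ f (Sum.inl j) := fun i j hij h =>
    hij (Sum.inl_injective (f.injective h))
  have hinr : ∀ i j, f (Sum.inr i) ≠ f (Sum.inl j) := fun i j h => by
    simpa using f.injective h
  have hedge : ∀ x y z, ({x, y, z} : Finset (Fin 7 ⊕ Fin t)) ∈ Fsim t →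
      ({f x, f y, f z} : Finset V) ∈ G := fun x y z h => by
    simpa [image_insert] using hf _ h
  refine hF (f (Sum.inl 0)) (f (Sum.inl 1)) (f (Sum.inl 2)) (f (Sum.inl 3)) (f (Sum.inl 4))
    (f (Sum.inl 5)) (f (Sum.inl 6)) (univ.map (Function.Embedding.inr.trans f))
    (hinl _ _ (by decide)) (hinl _ _ (by decide)) (hinl _ _ (by decide)) (hinl _ _ (by decide))
    (hinl _ _ (by decide)) (hinl _ _ (by decide)) (hinl _ _ (by decide)) (hinl _ _ (by decide))
    (hinl _ _ (by decide)) (hinl _ _ (by decide)) (hinl _ _ (by decide)) ?_ (by simp)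
    ⟨hinl _ _ (by decide), hinl _ _ (by decide), hinl _ _ (by decide), hedge _ _ _ ?_⟩
    ⟨hinl _ _ (by decide), hinl _ _ (by decide), hinl _ _ (by decide), hedge _ _ _ ?_⟩
    ⟨hinl _ _ (by decide), hinl _ _ (by decide), hinl _ _ (by decide), hedge _ _ _ ?_⟩
    ⟨hinl _ _ (by decide), hinl _ _ (by decide), hinl _ _ (by decide), hedge _ _ _ ?_⟩ ?_
  · intro u hu
    obtain ⟨j, -, rfl⟩ := mem_map.1 hu
    exact ⟨hinr _ _, hinr _ _, hinr _ _, hinr _ _, hinr _ _⟩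
  · simp [Fsim]
  · simp [Fsim]
  · simp [Fsim]
  · simp [Fsim]
  · intro u hu
    obtain ⟨j, -, rfl⟩ := mem_map.1 hu
    exact ⟨hinl _ _ (by decide), (hinr _ _).symm, (hinr _ _).symm, hedge _ _ _ (by simp [Fsim])⟩

variable [Fintype V]

lemma ofEdges_patternEdges (g : V → Colour) : ofEdges (patternEdges g) = pattern g := by
  have : (ofEdges (patternEdges g)).E = (pattern g).E := by
    ext a b c
    simp only [ofEdges, pattern, patternEdges, mem_filter, mem_univ, true_and]
    refine and_congr_right fun hab => and_congr_right fun hbc => and_congr_right fun hac => ?_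
    rw [card_eq_three.2 ⟨a, b, c, hab, hac, hbc, rfl⟩, sum_insert (by simp [hab, hac]),
      sum_pair hbc, add_assoc]
    simp
  cases h1 : ofEdges (patternEdges g)
  cases h2 : pattern g
  simpa [h1, h2] using this

lemma eq_patternEdges {G : Finset (Finset V)} (hG : ∀ e ∈ G, #e = 3) {g : V → Colour}
    (h : ∀ a b c, (ofEdges G).E a b c ↔ (pattern g).E a b c) : G = patternEdges g := by
  have key : ∀ e : Finset V, #e = 3 → (e ∈ G ↔ e ∈ patternEdges g) := by
    intro e he
    obtain ⟨a, b, c, hab, hac, hbc, rfl⟩ := card_eq_three.1 he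
    have := h a b c
    rw [← ofEdges_patternEdges] at this
    simpa [ofEdges, hab, hac, hbc] using this
  ext e
  exact ⟨fun he => (key e (hG e he)).1 he,
    fun he => (key e (card_of_mem_patternEdges e he)).2 he⟩

end Transfer

lemma patternEdges_eq_simConstr {n : ℕ} (g : Fin n → Colour) :
    patternEdges g = simConstr n (univ.filter fun v => g v = (0, 1))
      (univ.filter fun v => g v = (1, 0)) (univ.filter fun v => g v = (1, 1))
      (univ.filter fun v => g v = 0) := by
  ext e
  simp only [patternEdges, simConstr, mem_filter, mem_univ, true_and]
  refine and_congr_right fun he => ?_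
  have hcard : ∀ c, #(e ∩ univ.filter fun v => g v = c) = ∑ v ∈ e, if g v = c then 1 else 0 :=
    fun c => by rw [← card_filter, inter_filter, inter_univ]
  simp only [hcard]
  obtain ⟨x, y, z, hxy, hxz, hyz, rfl⟩ := card_eq_three.1 he
  simp only [sum_insert (show x ∉ ({y, z} : Finset (Fin n)) by simp [hxy, hxz]), sum_pair hyz,
    insert_subset_iff, singleton_subset_iff, mem_filter, mem_univ, true_and]
  generalize g x = i
  generalize g y = j
  generalize g z = k
  revert i j k
  decide

lemma card_le_exThree {n t : ℕ} {G : Finset (Finset (Fin n))} (hG : ∀ e ∈ G, #e = 3)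
    (hF : ¬ HasCopy G (Fsim t)) : #G ≤ exThree n (Fsim t) := by
  refine le_csSup ⟨#(univ : Finset (Finset (Fin n))), ?_⟩ ⟨G, hG, hF, rfl⟩
  rintro k ⟨H, -, -, rfl⟩
  exact card_le_univ H

end TripleSystem

open TripleSystem

theorem statement9 (t : ℕ) (ht : 1 ≤ t) :
    ∃ n0 : ℕ, ∀ n : ℕ, n ≥ n0 →
    ∀ G : Finset (Finset (Fin n)), (∀ e ∈ G, e.card = 3) → ¬ HasCopy G (Fsim t) →
    G.card = exThree n (Fsim t) →
    ∃ A B C X : Finset (Fin n),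
      Disjoint A B ∧ Disjoint A C ∧ Disjoint A X ∧
      Disjoint B C ∧ Disjoint B X ∧ Disjoint C X ∧
      A ∪ B ∪ C ∪ X = Finset.univ ∧ X.card = t ∧
      A.card ≤ B.card + 1 ∧ B.card ≤ A.card + 1 ∧
      A.card ≤ C.card + 1 ∧ C.card ≤ A.card + 1 ∧
      B.card ≤ C.card + 1 ∧ C.card ≤ B.card + 1 ∧
      G = simConstr n A B C X := by
  refine ⟨10 ^ 8 * (126 * (3 * t + 48)) ^ 3, fun n hn G hG hfree hmax => ?_⟩
  obtain ⟨g, hg0, hbal, heq⟩ := FsimFree.exists_eq_pattern (fsimFree_ofEdges hfree) ht le_rfl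
    (by simpa using hn) fun g hg => by
      rw [← ofEdges_patternEdges, cnt3_ofEdges card_of_mem_patternEdges, cnt3_ofEdges hG, hmax]
      refine Nat.mul_le_mul_left _ (card_le_exThree card_of_mem_patternEdges ?_)
      refine not_hasCopy_of_fsimFree ?_
      rw [ofEdges_patternEdges]
      exact pattern_fsimFree hg.le
  have hcs : ∀ c, #(univ.filter fun v => g v = c) = cs g c := fun c => by
    unfold cs cnt1
    congr
  have hdisj : ∀ c d : Colour, c ≠ d →
      Disjoint (univ.filter fun v => g v = c) (univ.filter fun v => g v = d) := fun c d hcd =>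
    disjoint_filter.2 fun v _ hc hd => hcd (hc.symm.trans hd)
  refine ⟨univ.filter fun v => g v = (0, 1), univ.filter fun v => g v = (1, 0),
    univ.filter fun v => g v = (1, 1), univ.filter fun v => g v = 0,
    hdisj _ _ (by decide), hdisj _ _ (by decide), hdisj _ _ (by decide), hdisj _ _ (by decide),
    hdisj _ _ (by decide), hdisj _ _ (by decide), ?_, (hcs 0).trans hg0, ?_, ?_, ?_, ?_, ?_, ?_,
    (eq_patternEdges hG heq).trans (patternEdges_eq_simConstr g)⟩
  · ext v
    simp only [mem_union, mem_filter, mem_univ, true_and, iff_true]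
    generalize g v = i
    revert i
    decide
  all_goals
    rw [hcs, hcs]
    exact hbal _ _ (by decide) (by decide)
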